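/- arXiv:2201.13159 — 7 statements merged into one kernel-verified Lean document; each statement's English description precedes it below -/
import Mathlib

section
/- Let s ∈ (0,1). The Bessel kernel K_s is integrable on ℝ, and its Fourier transform equals the Bessel symbol: for every ξ ∈ ℝ, ∫_ℝ K_s(x)·e^{−i x ξ} dx = (1 + ξ²)^{−s/2}. In particular ∫_ℝ K_s(x) dx = 1. -/
open MeasureTheory Set

/-- The Bessel kernel `K_s`. -/
noncomputable def besselKernel (s x : ℝ) : ℝ :=
  (1 / (2 * Real.sqrt Real.pi * Real.Gamma (s / 2))) *
    ∫ t in Set.Ioi (0 : ℝ), Real.exp (-t - x ^ 2 / (4 * t)) * t ^ ((s - 3) / 2)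

/-- A solution of the steady fKdV equation with wave speed `μ`: a bounded continuous
function satisfying the equation pointwise. -/
def IsFKdVSolution (s μ : ℝ) (φ : ℝ → ℝ) : Prop :=
  Continuous φ ∧ (∃ M, ∀ x, |φ x| ≤ M) ∧
    ∀ x, -μ * φ x + (φ x) ^ 2 / 2 + (∫ y, besselKernel s (x - y) * φ y) = 0

/-- The integrand defining the Bessel kernel. -/
noncomputable def besselIntegrand (s x t : ℝ) : ℝ :=
  Real.exp (-t - x ^ 2 / (4 * t)) * t ^ ((s - 3) / 2)

lemma besselIntegrand_eq (s x t : ℝ) :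
    besselIntegrand s x t =
      (Real.exp (-t) * t ^ ((s - 3) / 2)) * Real.exp (-(1 / (4 * t)) * x ^ 2) := by
  unfold besselIntegrand
  rw [show -t - x ^ 2 / (4 * t) = -t + -(1 / (4 * t)) * x ^ 2 by ring, Real.exp_add]
  ring

lemma sqrt_aux {t : ℝ} (ht : 0 < t) :
    √(Real.pi / (1 / (4 * t))) = 2 * √Real.pi * t ^ (1 / 2 : ℝ) := by
  rw [← Real.sqrt_eq_rpow, show Real.pi / (1 / (4 * t)) = 2 ^ 2 * (Real.pi * t) by
    field_simp; ring, Real.sqrt_mul (by positivity), Real.sqrt_sq (by norm_num),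
    Real.sqrt_mul Real.pi_pos.le]
  ring

lemma rpow_aux (s : ℝ) {t : ℝ} (ht : 0 < t) :
    t ^ ((s - 3) / 2) * t ^ (1 / 2 : ℝ) = t ^ (s / 2 - 1) := by
  rw [← Real.rpow_add ht]
  congr 1
  ring

lemma besselIntegrand_integral (s : ℝ) {t : ℝ} (ht : 0 < t) :
    ∫ x, besselIntegrand s x t = 2 * √Real.pi * (Real.exp (-t) * t ^ (s / 2 - 1)) := by
  simp_rw [besselIntegrand_eq]
  rw [integral_const_mul, integral_gaussian, sqrt_aux ht, ← rpow_aux s ht]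
  ring

lemma besselIntegrand_nonneg (s x : ℝ) {t : ℝ} (ht : 0 < t) : 0 ≤ besselIntegrand s x t := by
  unfold besselIntegrand
  positivity

lemma besselIntegrand_integrable (s : ℝ) (hs : 0 < s) :
    Integrable (fun p : ℝ × ℝ => besselIntegrand s p.1 p.2)
      (volume.prod (volume.restrict (Ioi 0))) := by
  have hm : Measurable (fun p : ℝ × ℝ => besselIntegrand s p.1 p.2) := by
    unfold besselIntegrand
    fun_prop
  rw [integrable_prod_iff' hm.aestronglyMeasurable]
  constructor
  · filter_upwards [ae_restrict_mem measurableSet_Ioi] with t ht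
    have ht : 0 < t := ht
    simp_rw [besselIntegrand_eq]
    exact (integrable_exp_neg_mul_sq (by positivity)).const_mul _
  · have h := (Real.GammaIntegral_convergent (s := s / 2) (by positivity)).const_mul
      (2 * √Real.pi)
    refine Integrable.congr h ?_
    filter_upwards [ae_restrict_mem measurableSet_Ioi] with t ht
    rw [← besselIntegrand_integral s ht]
    congr 1
    ext x
    rw [Real.norm_of_nonneg (besselIntegrand_nonneg s x ht)]

lemma besselIntegrand_fourier (s ξ : ℝ) {t : ℝ} (ht : 0 < t) :
    ∫ x : ℝ, (besselIntegrand s x t : ℂ) * Complex.exp (-(Complex.I * x * ξ)) =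
      ((2 * √Real.pi * (t ^ (s / 2 - 1) * Real.exp (-((1 + ξ ^ 2) * t))) : ℝ) : ℂ) := by
  have hb : (0 : ℝ) < 1 / (4 * t) := by positivity
  have key := fourierIntegral_gaussian (b := ((1 / (4 * t) : ℝ) : ℂ))
    (by rw [Complex.ofReal_re]; exact hb) ((-ξ : ℝ) : ℂ)
  have e1 : ((Real.pi : ℂ) / ((1 / (4 * t) : ℝ) : ℂ)) ^ (1 / 2 : ℂ) =
      ((2 * √Real.pi * t ^ (1 / 2 : ℝ) : ℝ) : ℂ) := by
    rw [← sqrt_aux ht, Real.sqrt_eq_rpow, Complex.ofReal_cpow (by positivity)]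
    norm_num
  have e2 : Complex.exp (-((-ξ : ℝ) : ℂ) ^ 2 / (4 * ((1 / (4 * t) : ℝ) : ℂ))) =
      ((Real.exp (-(ξ ^ 2 * t)) : ℝ) : ℂ) := by
    have : (t : ℂ) ≠ 0 := by exact_mod_cast ht.ne'
    push_cast
    congr 1
    field_simp
  rw [e1, e2] at key
  have h : ∀ x : ℝ, (besselIntegrand s x t : ℂ) * Complex.exp (-(Complex.I * x * ξ)) =
      ((Real.exp (-t) * t ^ ((s - 3) / 2) : ℝ) : ℂ) *
      (Complex.exp (Complex.I * ((-ξ : ℝ) : ℂ) * x) *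
        Complex.exp (-((1 / (4 * t) : ℝ) : ℂ) * x ^ 2)) := by
    intro x
    rw [besselIntegrand_eq, show -(Complex.I * x * ξ) = Complex.I * ((-ξ : ℝ) : ℂ) * x by
      push_cast; ring]
    rw [Complex.ofReal_mul, Complex.ofReal_exp (-(1 / (4 * t)) * x ^ 2)]
    push_cast
    ring
  simp_rw [h]
  rw [integral_const_mul, key, ← Complex.ofReal_mul, ← Complex.ofReal_mul, ← rpow_aux s ht,
    show -((1 + ξ ^ 2) * t) = -t + -(ξ ^ 2 * t) by ring, Real.exp_add]
  congr 1
  ring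

lemma besselKernel_eq (s x : ℝ) : besselKernel s x =
    (1 / (2 * √Real.pi * Real.Gamma (s / 2))) * ∫ t in Ioi (0 : ℝ), besselIntegrand s x t := rfl

lemma besselKernel_fourier_aux (s : ℝ) (hs : 0 < s) (ξ : ℝ) :
    (∫ x : ℝ, (besselKernel s x : ℂ) * Complex.exp (-(Complex.I * x * ξ)))
        = (((1 + ξ ^ 2) ^ (-s / 2) : ℝ) : ℂ) := by
  have hΓ : 0 < Real.Gamma (s / 2) := Real.Gamma_pos_of_pos (by positivity)
  have hint : Integrable (Function.uncurry fun x t : ℝ =>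
      (besselIntegrand s x t : ℂ) * Complex.exp (-(Complex.I * x * ξ)))
      (volume.prod (volume.restrict (Ioi 0))) := by
    refine (besselIntegrand_integrable s hs).ofReal.mul_bdd (c := 1)
      (g := fun p : ℝ × ℝ => Complex.exp (-(Complex.I * p.1 * ξ))) ?_ ?_
    · exact Measurable.aestronglyMeasurable (by fun_prop)
    · refine Filter.Eventually.of_forall fun p => ?_
      rw [Complex.norm_exp]
      simp
  have h : ∀ x : ℝ, (besselKernel s x : ℂ) * Complex.exp (-(Complex.I * x * ξ)) =
      ((1 / (2 * √Real.pi * Real.Gamma (s / 2)) : ℝ) : ℂ) *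
        ∫ t in Ioi (0 : ℝ), (besselIntegrand s x t : ℂ) *
          Complex.exp (-(Complex.I * x * ξ)) := by
    intro x
    rw [besselKernel_eq, integral_mul_const, integral_complex_ofReal, Complex.ofReal_mul,
      mul_assoc]
  simp_rw [h]
  rw [integral_const_mul, integral_integral_swap hint,
    setIntegral_congr_fun measurableSet_Ioi (fun t ht => besselIntegrand_fourier s ξ ht),
    integral_complex_ofReal, ← Complex.ofReal_mul, integral_const_mul,
    Real.integral_rpow_mul_exp_neg_mul_Ioi (by positivity) (by positivity)]
  congr 1
  rw [one_div (1 + ξ ^ 2), Real.inv_rpow (by positivity), ← Real.rpow_neg (by positivity),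
    neg_div]
  have := Real.sqrt_pos.2 Real.pi_pos
  field_simp

/-- The Bessel kernel is integrable, its Fourier transform is the Bessel symbol, and it
has unit mass. -/
theorem besselKernel_fourier (s : ℝ) (hs : s ∈ Set.Ioo (0 : ℝ) 1) :
    Integrable (besselKernel s) ∧
      (∀ ξ : ℝ, (∫ x : ℝ, (besselKernel s x : ℂ) * Complex.exp (-(Complex.I * x * ξ)))
        = (((1 + ξ ^ 2) ^ (-s / 2) : ℝ) : ℂ)) ∧
      (∫ x : ℝ, besselKernel s x) = 1 := by
  have hs0 : 0 < s := hs.1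
  refine ⟨?_, besselKernel_fourier_aux s hs0, ?_⟩
  · exact (besselIntegrand_integrable s hs0).integral_prod_left.const_mul _
  · have h := besselKernel_fourier_aux s hs0 0
    simp only [Complex.ofReal_zero, mul_zero, neg_zero, Complex.exp_zero, mul_one] at h
    rw [integral_complex_ofReal] at h
    have h2 := Complex.ofReal_injective h
    rw [h2]
    norm_num
end

section
/- Let s ∈ (0,1). Then: (i) there is a constant C > 0 such that K_s(x) ≤ C·e^{−|x|} for all |x| ≥ 1; (ii) there exist constants C_s > 0, C_s' ∈ ℝ and C > 0 such that the function H_s(x) := K_s(x) − C_s·|x|^{s−1}, which is twice differentiable on 0 < |x| < 1, satisfies |H_s(x) − C_s'| ≤ C·|x|^{s+1}, |H_s'(x)| ≤ C·|x|^{s} and |H_s''(x)| ≤ C·|x|^{s−1} for all 0 < |x| < 1. -/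
open MeasureTheory Set

lemma bk_integrable_J {a p : ℝ} (ha : 0 < a) (hp : 1 < p) :
    IntegrableOn (fun t : ℝ => Real.exp (-(a / t)) * t ^ (-p)) (Ioi 0) := by
  have h0 : IntegrableOn (fun u : ℝ => u ^ (p - 2) * Real.exp (-a * u)) (Ioi 0) := by
    have := integrableOn_rpow_mul_exp_neg_mul_rpow (p := 1) (s := p - 2) (b := a)
      (by linarith) (by norm_num) ha
    simpa using this
  have h1 := (integrableOn_Ioi_comp_rpow_iff (fun u : ℝ => u ^ (p - 2) * Real.exp (-a * u))
    (p := -1) (by norm_num)).2 h0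
  refine h1.congr_fun ?_ measurableSet_Ioi
  intro t ht
  have ht : 0 < t := ht
  simp only [smul_eq_mul, abs_neg, abs_one, one_mul]
  rw [← Real.rpow_mul ht.le, ← mul_assoc, ← Real.rpow_add ht, Real.rpow_neg_one, mul_comm]
  congr 1
  · congr 1; rw [div_eq_mul_inv]; ring
  · congr 1; ring

lemma bk_integrable_two {s M : ℝ} (hs : s ∈ Ioo (0 : ℝ) 1) {f : ℝ → ℝ} (hf : Measurable f)
    (h1 : ∀ t > 0, |f t| ≤ t ^ ((s - 1) / 2)) (h2 : ∀ t > 0, |f t| ≤ M * t ^ ((s - 3) / 2)) :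
    IntegrableOn f (Ioi 0) := by
  obtain ⟨hs0, hs1⟩ := hs
  rw [← Ioc_union_Ioi_eq_Ioi (zero_le_one (α := ℝ))]
  refine IntegrableOn.union ?_ ?_
  · have : IntegrableOn (fun t : ℝ => t ^ ((s - 1) / 2)) (Ioc 0 1) := by
      rw [← intervalIntegrable_iff_integrableOn_Ioc_of_le zero_le_one]
      exact intervalIntegral.intervalIntegrable_rpow' (by linarith)
    refine Integrable.mono' this hf.aestronglyMeasurable ?_
    filter_upwards [ae_restrict_mem measurableSet_Ioc] with t ht
    exact h1 t ht.1
  · have : IntegrableOn (fun t : ℝ => M * t ^ ((s - 3) / 2)) (Ioi 1) :=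
      (integrableOn_Ioi_rpow_of_lt (by linarith) one_pos).const_mul M
    refine Integrable.mono' this hf.aestronglyMeasurable ?_
    filter_upwards [ae_restrict_mem measurableSet_Ioi] with t ht
    exact h2 t (one_pos.trans ht)

/-- `J_p`. -/
noncomputable def bkJ (p x : ℝ) : ℝ :=
  ∫ t in Ioi (0 : ℝ), Real.exp (-(x ^ 2 / 4 / t)) * t ^ (-p)

/-- `Φ_p`. -/
noncomputable def bkPhi (p x : ℝ) : ℝ :=
  ∫ t in Ioi (0 : ℝ), (Real.exp (-t) - 1) * (Real.exp (-(x ^ 2 / 4 / t)) * t ^ (-p))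

lemma bk_scale {r x : ℝ} (hx : x ≠ 0) (g : ℝ → ℝ) :
    ∫ t in Ioi (0 : ℝ), g (x ^ 2 / 4 / t) * t ^ r
      = |x| ^ (2 * r + 2) * ∫ t in Ioi (0 : ℝ), g ((1 : ℝ) ^ 2 / 4 / t) * t ^ r := by
  have hx2 : 0 < x ^ 2 := by positivity
  have ha : 0 < |x| := abs_pos.2 hx
  have h := integral_comp_mul_left_Ioi (fun t : ℝ => g (x ^ 2 / 4 / t) * t ^ r) 0 hx2
  rw [mul_zero, smul_eq_mul, eq_comm, inv_mul_eq_iff_eq_mul₀ hx2.ne'] at h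
  rw [h, ← integral_const_mul, ← integral_const_mul]
  refine setIntegral_congr_fun measurableSet_Ioi ?_
  intro t ht
  have ht : 0 < t := ht
  simp only
  have e1 : x ^ 2 / 4 / (x ^ 2 * t) = 1 ^ 2 / 4 / t := by field_simp; try norm_num
  rw [e1, Real.mul_rpow hx2.le ht.le]
  have e2 : |x| ^ (2 * r + 2) = x ^ 2 * (x ^ 2) ^ r := by
    rw [Real.rpow_add ha, Real.rpow_mul ha.le]
    have : |x| ^ (2 : ℝ) = x ^ 2 := by rw [Real.rpow_two, sq_abs]
    rw [this]; ring
  rw [e2]; ring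

lemma bkJ_scale {p x : ℝ} (hx : x ≠ 0) : bkJ p x = |x| ^ (2 - 2 * p) * bkJ p 1 := by
  have := bk_scale (r := -p) hx (fun u => Real.exp (-u))
  unfold bkJ
  rw [this]; congr 2; ring

lemma bkJ_pos {p x : ℝ} (hp : 1 < p) (hx : x ≠ 0) : 0 < bkJ p x := by
  unfold bkJ
  rw [setIntegral_pos_iff_support_of_nonneg_ae]
  · have : Ioi (0 : ℝ) ⊆ Function.support
      (fun t : ℝ => Real.exp (-(x ^ 2 / 4 / t)) * t ^ (-p)) := by
      intro t ht
      have ht : 0 < t := ht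
      exact (mul_pos (Real.exp_pos _) (Real.rpow_pos_of_pos ht _)).ne'
    rw [inter_eq_self_of_subset_right this]
    simp
  · filter_upwards [ae_restrict_mem measurableSet_Ioi] with t ht
    have ht : 0 < t := ht
    simp only [Pi.zero_apply]
    positivity
  · exact bk_integrable_J (by positivity) hp

lemma bk_abs_exp {t : ℝ} (ht : 0 < t) : |Real.exp (-t) - 1| ≤ 1 ∧ |Real.exp (-t) - 1| ≤ t := by
  have h1 : Real.exp (-t) ≤ 1 := Real.exp_le_one_iff.2 (by linarith)
  have h2 := Real.exp_pos (-t)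
  have h3 := Real.add_one_le_exp (-t)
  constructor <;> rw [abs_le] <;> constructor <;> linarith

lemma bkPhi_integrable {p x : ℝ} (hp : 1 < p) (hx : x ≠ 0) :
    IntegrableOn (fun t : ℝ => (Real.exp (-t) - 1) * (Real.exp (-(x ^ 2 / 4 / t)) * t ^ (-p)))
      (Ioi 0) := by
  refine Integrable.mono' (bk_integrable_J (a := x ^ 2 / 4) (by positivity) hp)
    (Measurable.aestronglyMeasurable (by fun_prop)) ?_
  filter_upwards [ae_restrict_mem measurableSet_Ioi] with t ht
  have ht : 0 < t := ht
  rw [Real.norm_eq_abs, abs_mul]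
  have h : 0 < Real.exp (-(x ^ 2 / 4 / t)) * t ^ (-p) := by positivity
  rw [abs_of_pos h]
  have := (bk_abs_exp ht).1
  nlinarith

lemma bkPhi_bound {q x : ℝ} (hq : 1 < q) (hx : x ≠ 0) :
    |bkPhi (q + 1) x| ≤ |x| ^ (2 - 2 * q) * bkJ q 1 := by
  rw [← bkJ_scale hx]
  unfold bkPhi bkJ
  rw [← Real.norm_eq_abs]
  refine norm_integral_le_of_norm_le (bk_integrable_J (a := x ^ 2 / 4) (by positivity) hq) ?_
  filter_upwards [ae_restrict_mem measurableSet_Ioi] with t ht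
  have ht : 0 < t := ht
  rw [Real.norm_eq_abs, abs_mul]
  have h : 0 < Real.exp (-(x ^ 2 / 4 / t)) * t ^ (-(q + 1)) := by positivity
  rw [abs_of_pos h]
  have e : t ^ (-q) = t * t ^ (-(q + 1)) := by
    rw [← Real.rpow_one_add' ht.le]
    · congr 1; ring
    · intro h0; linarith
  rw [e]
  have := (bk_abs_exp ht).2
  nlinarith

lemma bkPhi_hasDerivAt {p x : ℝ} (hp : 1 < p) (hx : x ≠ 0) :
    HasDerivAt (bkPhi p) (-(x / 2) * bkPhi (p + 1) x) x := by
  have ha : 0 < |x| := abs_pos.2 hx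
  have key := hasDerivAt_integral_of_dominated_loc_of_deriv_le
    (μ := volume.restrict (Ioi (0 : ℝ))) (x₀ := x)
    (s := Metric.ball x (|x| / 2))
    (F := fun y t => (Real.exp (-t) - 1) * (Real.exp (-(y ^ 2 / 4 / t)) * t ^ (-p)))
    (F' := fun y t => -(y / 2) *
      ((Real.exp (-t) - 1) * (Real.exp (-(y ^ 2 / 4 / t)) * t ^ (-(p + 1)))))
    (bound := fun t => |x| * (Real.exp (-(x ^ 2 / 16 / t)) * t ^ (-(p + 1))))
    (Metric.ball_mem_nhds x (by positivity))
    (Filter.Eventually.of_forall fun y => Measurable.aestronglyMeasurable (by fun_prop))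
    (bkPhi_integrable hp hx)
    (Measurable.aestronglyMeasurable (by fun_prop))
    ?_ ((bk_integrable_J (a := x ^ 2 / 16) (by positivity) (by linarith)).const_mul |x|) ?_
  · have h2 := key.2
    rw [integral_const_mul] at h2
    exact h2
  · filter_upwards [ae_restrict_mem measurableSet_Ioi] with t ht y hy
    have ht : 0 < t := ht
    rw [Metric.mem_ball, Real.dist_eq] at hy
    have b1 : |x| / 2 ≤ |y| := by
      have := abs_sub_abs_le_abs_sub x y
      rw [abs_sub_comm] at this; linarith
    have b2 : |y| ≤ 2 * |x| := by
      have := abs_sub_abs_le_abs_sub y x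
      linarith
    have b3 : x ^ 2 / 16 ≤ y ^ 2 / 4 := by
      rw [← sq_abs x, ← sq_abs y]; nlinarith
    have b4 : Real.exp (-(y ^ 2 / 4 / t)) ≤ Real.exp (-(x ^ 2 / 16 / t)) := by
      apply Real.exp_le_exp.2
      have : x ^ 2 / 16 / t ≤ y ^ 2 / 4 / t := by gcongr
      linarith
    have hr : 0 < t ^ (-(p + 1)) := by positivity
    rw [Real.norm_eq_abs, abs_mul, abs_mul, abs_mul, abs_of_pos hr, abs_of_pos (Real.exp_pos _)]
    have b5 : |-(y / 2)| ≤ |x| := by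
      rw [abs_neg, abs_div, abs_two]; linarith
    have b6 := (bk_abs_exp ht).1
    calc _ ≤ |x| * (1 * (Real.exp (-(x ^ 2 / 16 / t)) * t ^ (-(p + 1)))) := by gcongr
      _ = _ := by ring
  · filter_upwards [ae_restrict_mem measurableSet_Ioi] with t ht y hy
    have ht : 0 < t := ht
    have e : t ^ (-p) = t * t ^ (-(p + 1)) := by
      rw [← Real.rpow_one_add' ht.le]
      · congr 1; ring
      · intro h0; linarith
    have h1 : HasDerivAt (fun y : ℝ => -(y ^ 2 / 4 / t)) (-(2 * y / 4 / t)) y := by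
      have := (((hasDerivAt_pow 2 y).div_const 4).div_const t).neg
      have e5 : -(2 * y / 4 / t) = -(((2 : ℕ) : ℝ) * y ^ (2 - 1) / 4 / t) := by norm_num
      rw [e5]
      exact this
    have h2 := (h1.exp.mul_const (t ^ (-p))).const_mul (Real.exp (-t) - 1)
    refine h2.congr_deriv ?_
    rw [e]; field_simp; try ring

lemma bk_eq {s x : ℝ} (hs : s ∈ Ioo (0 : ℝ) 1) (hx : x ≠ 0) :
    (∫ t in Ioi (0 : ℝ), Real.exp (-t - x ^ 2 / (4 * t)) * t ^ ((s - 3) / 2))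
      = bkPhi ((3 - s) / 2) x + |x| ^ (s - 1) * bkJ ((3 - s) / 2) 1 := by
  have hp : 1 < (3 - s) / 2 := by linarith [hs.2]
  have e : |x| ^ (s - 1) * bkJ ((3 - s) / 2) 1 = bkJ ((3 - s) / 2) x := by
    rw [bkJ_scale hx]; congr 2; ring
  rw [e]
  unfold bkPhi bkJ
  rw [← integral_add (bkPhi_integrable hp hx) (bk_integrable_J (by positivity) hp)]
  refine setIntegral_congr_fun measurableSet_Ioi ?_
  intro t ht
  have ht : 0 < t := ht
  simp only
  have e1 : -t - x ^ 2 / (4 * t) = -t + -(x ^ 2 / 4 / t) := by field_simp; try ring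
  have e2 : (s - 3) / 2 = -((3 - s) / 2) := by ring
  rw [e1, e2, Real.exp_add]; ring

lemma bkPhi_zero_bound {s : ℝ} (hs : s ∈ Ioo (0 : ℝ) 1) : ∃ A B : ℝ, 0 ≤ B ∧ ∀ x : ℝ, x ≠ 0 →
    |bkPhi ((3 - s) / 2) x - A| ≤ B * |x| ^ (s + 1) := by
  have hp : 1 < (3 - s) / 2 := by linarith [hs.2]
  have ee : ∀ t : ℝ, 0 < t → t ^ ((s - 1) / 2) = t * t ^ (-((3 - s) / 2)) := by
    intro t ht
    rw [← Real.rpow_one_add' ht.le]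
    · congr 1; ring
    · intro h0; linarith [hs.2]
  have e2 : (s - 3) / 2 = -((3 - s) / 2) := by ring
  have hA : IntegrableOn (fun t : ℝ => (Real.exp (-t) - 1) * t ^ (-((3 - s) / 2))) (Ioi 0) := by
    refine bk_integrable_two (M := 1) hs (by fun_prop) ?_ ?_
    · intro t ht
      have hr : 0 < t ^ (-((3 - s) / 2)) := by positivity
      rw [ee t ht, abs_mul, abs_of_pos hr]
      have := (bk_abs_exp ht).2
      gcongr
    · intro t ht
      have hr : 0 < t ^ (-((3 - s) / 2)) := by positivity
      rw [e2, abs_mul, abs_of_pos hr]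
      have := (bk_abs_exp ht).1
      gcongr
  have hB : ∀ x : ℝ, x ≠ 0 →
      IntegrableOn (fun t : ℝ => |Real.exp (-(x ^ 2 / 4 / t)) - 1| * t ^ ((s - 1) / 2)) (Ioi 0) := by
    intro x hx
    refine bk_integrable_two (M := x ^ 2 / 4) hs (by fun_prop) ?_ ?_
    · intro t ht
      have hr : 0 < t ^ ((s - 1) / 2) := by positivity
      rw [abs_mul, abs_of_pos hr, abs_abs]
      have := (bk_abs_exp (t := x ^ 2 / 4 / t) (by positivity)).1
      nlinarith
    · intro t ht
      have hr : 0 < t ^ (-((3 - s) / 2)) := by positivity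
      have hr' : 0 < t ^ ((s - 1) / 2) := by positivity
      rw [abs_mul, abs_of_pos hr', abs_abs, ee t ht, e2]
      have := (bk_abs_exp (t := x ^ 2 / 4 / t) (by positivity)).2
      calc _ ≤ (x ^ 2 / 4 / t) * (t * t ^ (-((3 - s) / 2))) := by gcongr
        _ = _ := by field_simp
  refine ⟨∫ t in Ioi (0 : ℝ), (Real.exp (-t) - 1) * t ^ (-((3 - s) / 2)),
    ∫ t in Ioi (0 : ℝ), |Real.exp (-((1 : ℝ) ^ 2 / 4 / t)) - 1| * t ^ ((s - 1) / 2), ?_, ?_⟩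
  · refine setIntegral_nonneg measurableSet_Ioi ?_
    intro t ht
    have ht : 0 < t := ht
    positivity
  intro x hx
  have hsc := bk_scale (r := (s - 1) / 2) hx (fun u => |Real.exp (-u) - 1|)
  have e3 : 2 * ((s - 1) / 2) + 2 = s + 1 := by ring
  rw [e3] at hsc
  rw [mul_comm, ← hsc]
  unfold bkPhi
  rw [← integral_sub (bkPhi_integrable hp hx) hA, ← Real.norm_eq_abs]
  refine norm_integral_le_of_norm_le (hB x hx) ?_
  filter_upwards [ae_restrict_mem measurableSet_Ioi] with t ht
  have ht : 0 < t := ht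
  have hr : 0 < t ^ (-((3 - s) / 2)) := by positivity
  have e4 : (Real.exp (-t) - 1) * (Real.exp (-(x ^ 2 / 4 / t)) * t ^ (-((3 - s) / 2)))
      - (Real.exp (-t) - 1) * t ^ (-((3 - s) / 2))
      = (Real.exp (-t) - 1) * (Real.exp (-(x ^ 2 / 4 / t)) - 1) * t ^ (-((3 - s) / 2)) := by ring
  rw [e4, Real.norm_eq_abs, abs_mul, abs_mul, abs_of_pos hr, ee t ht]
  have := (bk_abs_exp ht).2
  calc _ ≤ t * |Real.exp (-(x ^ 2 / 4 / t)) - 1| * t ^ (-((3 - s) / 2)) := by gcongr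
    _ = _ := by ring

lemma bk_decay {s : ℝ} (hs : s ∈ Ioo (0 : ℝ) 1) : ∃ C > 0, ∀ x : ℝ, 1 ≤ |x| →
    (∫ t in Ioi (0 : ℝ), Real.exp (-t - x ^ 2 / (4 * t)) * t ^ ((s - 3) / 2))
      ≤ C * Real.exp (-|x|) := by
  have hp : 1 < (3 - s) / 2 := by linarith [hs.2]
  have e2 : (s - 3) / 2 = -((3 - s) / 2) := by ring
  have hI := bk_integrable_J (a := (1 / 2 : ℝ) ^ 2 / 4) (by positivity) hp
  refine ⟨Real.exp (1 / 4) * bkJ ((3 - s) / 2) (1 / 2),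
    mul_pos (Real.exp_pos _) (bkJ_pos hp (by norm_num)), ?_⟩
  intro x hx
  have : Real.exp (1 / 4) * bkJ ((3 - s) / 2) (1 / 2) * Real.exp (-|x|)
     = ∫ t in Ioi (0 : ℝ), (Real.exp (1 / 4) * Real.exp (-|x|)) *
      (Real.exp (-((1 / 2 : ℝ) ^ 2 / 4 / t)) * t ^ (-((3 - s) / 2))) := by
    rw [integral_const_mul]; unfold bkJ; ring
  rw [this]
  refine integral_mono_of_nonneg ?_ (hI.const_mul _) ?_
  · filter_upwards [ae_restrict_mem measurableSet_Ioi] with t ht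
    have ht : 0 < t := ht
    simp only [Pi.zero_apply]
    positivity
  · filter_upwards [ae_restrict_mem measurableSet_Ioi] with t ht
    have ht : 0 < t := ht
    rw [e2, ← mul_assoc, ← Real.exp_add, ← Real.exp_add]
    have : -t - x ^ 2 / (4 * t) ≤ 1 / 4 + -|x| + -((1 / 2) ^ 2 / 4 / t) := by
      rw [← sq_abs x]
      generalize |x| = a at *
      have h : 0 ≤ (4 * (a - 2 * t) ^ 2 - 1 + 4 * t) / (16 * t) := by
        apply div_nonneg _ (by positivity)
        rcases le_total t (1 / 4) with h | h
        · nlinarith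
        · nlinarith [sq_nonneg (a - 2 * t)]
      have h' : (4 * (a - 2 * t) ^ 2 - 1 + 4 * t) / (16 * t)
        = (1 / 4 + -a + -((1 / 2) ^ 2 / 4 / t)) - (-t - a ^ 2 / (4 * t)) := by
        field_simp; ring
      linarith
    gcongr

/-- Asymptotic behavior of the Bessel kernel: exponential decay at infinity and a
`|x|^(s-1)` singularity plus a regular part near the origin. -/
theorem besselKernel_asymptotics (s : ℝ) (hs : s ∈ Set.Ioo (0 : ℝ) 1) :
    (∃ C > 0, ∀ x : ℝ, 1 ≤ |x| → besselKernel s x ≤ C * Real.exp (-|x|)) ∧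
      ∃ (Cs : ℝ) (Cs' : ℝ) (C : ℝ), 0 < Cs ∧ 0 < C ∧
        (∀ x : ℝ, 0 < |x| → |x| < 1 →
          DifferentiableAt ℝ (fun y => besselKernel s y - Cs * |y| ^ (s - 1)) x ∧
          DifferentiableAt ℝ
            (deriv (fun y => besselKernel s y - Cs * |y| ^ (s - 1))) x ∧
          |(besselKernel s x - Cs * |x| ^ (s - 1)) - Cs'| ≤ C * |x| ^ (s + 1) ∧
          |deriv (fun y => besselKernel s y - Cs * |y| ^ (s - 1)) x| ≤ C * |x| ^ s ∧
          |deriv (deriv (fun y => besselKernel s y - Cs * |y| ^ (s - 1))) x|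
            ≤ C * |x| ^ (s - 1)) := by
  set c := 1 / (2 * Real.sqrt Real.pi * Real.Gamma (s / 2)) with hc
  have hcpos : 0 < c := by
    have := Real.Gamma_pos_of_pos (half_pos hs.1)
    have := Real.sqrt_pos.2 Real.pi_pos
    positivity
  set p := (3 - s) / 2 with hpdef
  have hp : 1 < p := by rw [hpdef]; linarith [hs.2]
  constructor
  · obtain ⟨C, hC, h⟩ := bk_decay hs
    refine ⟨c * C, mul_pos hcpos hC, fun x hx => ?_⟩
    unfold besselKernel
    rw [mul_assoc c]
    exact mul_le_mul_of_nonneg_left (h x hx) hcpos.le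
  obtain ⟨A, B, hB, hAB⟩ := bkPhi_zero_bound hs
  have hJ := bkJ_pos hp one_ne_zero
  have hJ1 := bkJ_pos (p := p + 1) (by linarith) one_ne_zero
  set J := bkJ p 1
  set J1 := bkJ (p + 1) 1
  set H : ℝ → ℝ := fun y => besselKernel s y - (c * J) * |y| ^ (s - 1) with hH
  have hHeq : ∀ y : ℝ, y ≠ 0 → H y = c * bkPhi p y := by
    intro y hy
    simp only [hH]
    unfold besselKernel
    rw [bk_eq hs hy, ← hc]; ring
  have hD1 : ∀ y : ℝ, y ≠ 0 → HasDerivAt H (c * (-(y / 2) * bkPhi (p + 1) y)) y := by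
    intro y hy
    refine ((bkPhi_hasDerivAt hp hy).const_mul c).congr_of_eventuallyEq ?_
    filter_upwards [isOpen_ne.mem_nhds hy] with z hz
    exact hHeq z hz
  have hD2 : ∀ y : ℝ, y ≠ 0 → HasDerivAt (deriv H)
      (c * (-(1 / 2) * bkPhi (p + 1) y + -(y / 2) * (-(y / 2) * bkPhi (p + 1 + 1) y))) y := by
    intro y hy
    have h := ((((hasDerivAt_id y).div_const 2).neg).mul
      (bkPhi_hasDerivAt (p := p + 1) (by linarith) hy)).const_mul c
    refine h.congr_of_eventuallyEq ?_
    filter_upwards [isOpen_ne.mem_nhds hy] with z hz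
    exact (hD1 z hz).deriv
  refine ⟨c * J, c * A, c * B + c * J + c * J1, by positivity, by positivity, ?_⟩
  intro x hx0 _
  have hx : x ≠ 0 := abs_pos.1 hx0
  have b1 := bkPhi_bound hp hx
  have b2 := bkPhi_bound (q := p + 1) (by linarith) hx
  have r1 : |x| * |x| ^ (2 - 2 * p) = |x| ^ s := by
    rw [← Real.rpow_one_add' hx0.le]
    · congr 1; rw [hpdef]; ring
    · rw [hpdef]; intro h; linarith [hs.1]
  have r2 : |x| ^ (2 - 2 * p) = |x| ^ (s - 1) := by congr 1; rw [hpdef]; ring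
  have r3 : |x| ^ 2 * |x| ^ (2 - 2 * (p + 1)) = |x| ^ (s - 1) := by
    rw [← Real.rpow_natCast, ← Real.rpow_add hx0]
    congr 1; rw [hpdef]; push_cast; ring
  refine ⟨(hD1 x hx).differentiableAt, (hD2 x hx).differentiableAt, ?_, ?_, ?_⟩
  · have h := hHeq x hx
    simp only [hH] at h
    rw [h, ← mul_sub, abs_mul, abs_of_pos hcpos]
    have hh := mul_le_mul_of_nonneg_left (hAB x hx) hcpos.le
    have : 0 ≤ (c * J + c * J1) * |x| ^ (s + 1) := by positivity
    calc _ ≤ c * (B * |x| ^ (s + 1)) := hh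
      _ ≤ _ := by linarith
  · rw [(hD1 x hx).deriv, abs_mul, abs_mul, abs_of_pos hcpos, abs_neg, abs_div, abs_two]
    have : 0 ≤ (c * B + c * J / 2 + c * J1) * |x| ^ s := by positivity
    calc _ ≤ c * (|x| / 2 * (|x| ^ (2 - 2 * p) * J)) := by gcongr
      _ = c * J / 2 * |x| ^ s := by rw [← r1]; ring
      _ ≤ _ := by linarith
  · rw [(hD2 x hx).deriv, abs_mul, abs_of_pos hcpos]
    have : 0 ≤ (c * B + c * J / 2 + c * J1 * (3 / 4)) * |x| ^ (s - 1) := by positivity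
    calc _ ≤ c * (1 / 2 * (|x| ^ (2 - 2 * p) * J)
          + |x| / 2 * (|x| / 2 * (|x| ^ (2 - 2 * (p + 1)) * J1))) := by
          refine mul_le_mul_of_nonneg_left ((abs_add_le _ _).trans ?_) hcpos.le
          rw [abs_mul, abs_mul, abs_mul, abs_neg, abs_neg, abs_div x, abs_two,
            abs_of_pos (by norm_num : (0 : ℝ) < 1 / 2)]
          gcongr
      _ = c * J / 2 * |x| ^ (2 - 2 * p)
          + c * J1 / 4 * (|x| ^ 2 * |x| ^ (2 - 2 * (p + 1))) := by ring
      _ = c * J / 2 * |x| ^ (s - 1) + c * J1 / 4 * |x| ^ (s - 1) := by rw [r2, r3]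
      _ ≤ _ := by linarith
end

section
/- Let s ∈ (0,1). The Bessel kernel K_s is completely monotone on (0, ∞) with strict inequalities: K_s is infinitely differentiable on (0, ∞) and for every n ∈ ℕ (including n = 0) and every x > 0, (−1)^n · K_s^{(n)}(x) > 0, where K_s^{(n)} denotes the n-th derivative. In particular K_s is strictly decreasing and strictly convex on (0, ∞). -/
open MeasureTheory Set

/-- The exponent function in the Laplace representation. -/
noncomputable def bkX (t : ℝ) : ℝ := -((t + t⁻¹) / 2)

/-- The measure `t^(a-1) dt` on `(0, ∞)`. -/
noncomputable def bkM (a : ℝ) : Measure ℝ :=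
  (volume.restrict (Set.Ioi (0 : ℝ))).withDensity (fun t => ENNReal.ofReal (t ^ (a - 1)))

lemma bk_measurable (a : ℝ) : Measurable (fun t : ℝ => ENNReal.ofReal (t ^ (a - 1))) := by
  fun_prop

lemma bk_integral (a : ℝ) (g : ℝ → ℝ) :
    ∫ t, g t ∂(bkM a) = ∫ t in Set.Ioi (0 : ℝ), t ^ (a - 1) * g t := by
  rw [bkM, integral_withDensity_eq_integral_toReal_smul (bk_measurable a) (by simp)]
  refine setIntegral_congr_fun measurableSet_Ioi fun t ht => ?_
  have ht' : 0 < t := ht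
  simp only [smul_eq_mul]
  rw [ENNReal.toReal_ofReal (by positivity)]

lemma bk_integrable (a : ℝ) (g : ℝ → ℝ) :
    Integrable g (bkM a) ↔ IntegrableOn (fun t => t ^ (a - 1) * g t) (Set.Ioi (0 : ℝ)) := by
  rw [bkM, integrable_withDensity_iff_integrable_smul' (bk_measurable a) (by simp)]
  refine integrableOn_congr_fun (fun t ht => ?_) measurableSet_Ioi
  have ht' : 0 < t := ht
  simp only [smul_eq_mul]
  rw [ENNReal.toReal_ofReal (by positivity)]

lemma bk_mem (a : ℝ) (ha : -1 < a) {x : ℝ} (hx : 0 < x) :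
    x ∈ ProbabilityTheory.integrableExpSet bkX (bkM a) := by
  change Integrable (fun t => Real.exp (x * bkX t)) (bkM a)
  rw [bk_integrable]
  have h := (integrableOn_rpow_mul_exp_neg_mul_rpow (p := 1) (b := x / 2) ha one_pos
    (half_pos hx)).const_mul (2 / x)
  refine Integrable.mono' h ?_ ?_
  · apply Measurable.aestronglyMeasurable
    unfold bkX
    fun_prop
  · refine (ae_restrict_iff' measurableSet_Ioi).2 (Filter.Eventually.of_forall fun t ht => ?_)
    have ht' : 0 < t := ht
    rw [Real.norm_of_nonneg (by positivity)]
    have e1 : Real.exp (x * bkX t) = Real.exp (-(x / 2) * t) * Real.exp (-(x / (2 * t))) := by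
      rw [← Real.exp_add]
      congr 1
      unfold bkX
      field_simp
      ring
    have e2 : Real.exp (-(x / (2 * t))) ≤ 2 / x * t := by
      rw [Real.exp_neg, inv_le_comm₀ (Real.exp_pos _) (by positivity)]
      have := Real.add_one_le_exp (x / (2 * t))
      have e3 : (2 / x * t)⁻¹ = x / (2 * t) := by field_simp
      rw [e3]
      linarith
    have e4 : t ^ a = t ^ (a - 1) * t := by
      rw [← Real.rpow_add_one ht'.ne']
      ring_nf
    rw [e1, Real.rpow_one, e4]
    calc t ^ (a - 1) * (Real.exp (-(x / 2) * t) * Real.exp (-(x / (2 * t))))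
        ≤ t ^ (a - 1) * (Real.exp (-(x / 2) * t) * (2 / x * t)) := by gcongr
      _ = _ := by ring

lemma bk_mem_interior (a : ℝ) (ha : -1 < a) {x : ℝ} (hx : 0 < x) :
    x ∈ interior (ProbabilityTheory.integrableExpSet bkX (bkM a)) :=
  interior_maximal (fun _ hy => bk_mem a ha hy) isOpen_Ioi (show x ∈ Set.Ioi (0 : ℝ) from hx)

/-- Strict complete monotonicity. -/
def StrictCM (f : ℝ → ℝ) : Prop :=
  (∀ x, 0 < x → ContDiffAt ℝ (⊤ : ℕ∞) f x) ∧
    ∀ (n : ℕ) (x : ℝ), 0 < x → 0 < (-1 : ℝ) ^ n * iteratedDeriv n f x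

lemma strictCM_mgf (a : ℝ) (ha : -1 < a) : StrictCM (ProbabilityTheory.mgf bkX (bkM a)) := by
  refine ⟨fun x hx => (ProbabilityTheory.analyticAt_mgf (bk_mem_interior a ha hx)).contDiffAt,
    fun n x hx => ?_⟩
  have hm := bk_mem_interior a ha hx
  rw [ProbabilityTheory.iteratedDeriv_mgf hm, ← integral_const_mul, bk_integral]
  have hi := (ProbabilityTheory.integrable_pow_mul_exp_of_mem_interior_integrableExpSet
    hm n).const_mul ((-1 : ℝ) ^ n)
  rw [bk_integrable] at hi
  have hpos : ∀ t ∈ Set.Ioi (0 : ℝ),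
      0 < t ^ (a - 1) * ((-1 : ℝ) ^ n * (bkX t ^ n * Real.exp (x * bkX t))) := by
    intro t ht
    have ht' : 0 < t := ht
    have : (-1 : ℝ) ^ n * (bkX t ^ n * Real.exp (x * bkX t)) =
        ((t + t⁻¹) / 2) ^ n * Real.exp (x * bkX t) := by
      rw [← mul_assoc, ← mul_pow]
      congr 2
      unfold bkX
      ring
    rw [this]
    positivity
  rw [setIntegral_pos_iff_support_of_nonneg_ae _ hi]
  · have : Set.Ioi (0 : ℝ) ⊆ (Function.support fun t : ℝ =>
      t ^ (a - 1) * ((-1 : ℝ) ^ n * (bkX t ^ n * Real.exp (x * bkX t)))) :=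
      fun t ht => (hpos t ht).ne'
    rw [Set.inter_eq_self_of_subset_right this]
    simp
  · exact (ae_restrict_iff' measurableSet_Ioi).2
      (Filter.Eventually.of_forall fun t ht => (hpos t ht).le)

lemma strictCM_rpow (a : ℝ) (ha : a < 0) : StrictCM (fun x => x ^ a) := by
  refine ⟨fun x hx => Real.contDiffAt_rpow_const_of_ne hx.ne', fun n x hx => ?_⟩
  rw [iteratedDeriv_eq_iterate, Real.iter_deriv_rpow_const, ← mul_assoc]
  refine mul_pos ?_ (by positivity)
  induction n with
  | zero => simp
  | succ n ih =>
    rw [descPochhammer_succ_eval]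
    have : (-1 : ℝ) ^ (n + 1) * (Polynomial.eval a (descPochhammer ℝ n) * (a - n)) =
        ((-1 : ℝ) ^ n * Polynomial.eval a (descPochhammer ℝ n)) * (n - a) := by ring
    rw [this]
    have : (0 : ℝ) ≤ n := n.cast_nonneg
    exact mul_pos ih (by linarith)

lemma StrictCM.mul {f g : ℝ → ℝ} (hf : StrictCM f) (hg : StrictCM g) : StrictCM (f * g) := by
  refine ⟨fun x hx => (hf.1 x hx).mul (hg.1 x hx), fun n x hx => ?_⟩
  have hn : ((n : ℕ∞) : WithTop ℕ∞) ≤ ((⊤ : ℕ∞) : WithTop ℕ∞) := by exact_mod_cast le_top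
  rw [iteratedDeriv_mul ((hf.1 x hx).of_le hn) ((hg.1 x hx).of_le hn), Finset.mul_sum]
  refine Finset.sum_pos (fun i hi => ?_) ⟨0, by simp⟩
  have hi' : i ≤ n := by simpa [Nat.lt_succ_iff] using hi
  have e : (-1 : ℝ) ^ n = (-1) ^ i * (-1) ^ (n - i) := by rw [← pow_add]; congr 1; omega
  have h3 : (0 : ℝ) < n.choose i := by exact_mod_cast Nat.choose_pos hi'
  have := mul_pos h3 (mul_pos (hf.2 i x hx) (hg.2 (n - i) x hx))
  rw [e]
  convert this using 1
  ring

lemma StrictCM.const_mul {f : ℝ → ℝ} (hf : StrictCM f) {c : ℝ} (hc : 0 < c) :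
    StrictCM (fun x => c * f x) := by
  refine ⟨fun x hx => contDiffAt_const.mul (hf.1 x hx), fun n x hx => ?_⟩
  rw [iteratedDeriv_const_mul_field, mul_left_comm]
  exact mul_pos hc (hf.2 n x hx)

lemma StrictCM.congr {f g : ℝ → ℝ} (hf : StrictCM f) (h : ∀ x, 0 < x → g x = f x) :
    StrictCM g := by
  have he : ∀ x, 0 < x → g =ᶠ[nhds x] f := fun x hx => by
    filter_upwards [eventually_gt_nhds hx] with y hy using h y hy
  refine ⟨fun x hx => (hf.1 x hx).congr_of_eventuallyEq (he x hx), fun n x hx => ?_⟩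
  rw [(he x hx).iteratedDeriv_eq]
  exact hf.2 n x hx

lemma bk_eq_s5 (s : ℝ) {x : ℝ} (hx : 0 < x) :
    besselKernel s x = ((1 / (2 * Real.sqrt Real.pi * Real.Gamma (s / 2))) *
      (1 / 2) ^ ((s - 1) / 2)) * (((fun x : ℝ => x ^ ((s - 1) / 2)) *
        ProbabilityTheory.mgf bkX (bkM ((s - 1) / 2)) : ℝ → ℝ) x) := by
  have hb : 0 < x / 2 := by positivity
  have h := integral_comp_mul_left_Ioi
    (fun t : ℝ => Real.exp (-t - x ^ 2 / (4 * t)) * t ^ ((s - 3) / 2)) 0 hb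
  rw [mul_zero, smul_eq_mul, eq_comm, inv_mul_eq_iff_eq_mul₀ hb.ne'] at h
  rw [besselKernel, h, Pi.mul_apply, ProbabilityTheory.mgf, bk_integral,
    mul_assoc (1 / (2 * Real.sqrt Real.pi * Real.Gamma (s / 2)))]
  congr 1
  rw [← mul_assoc, ← integral_const_mul, ← integral_const_mul]
  refine setIntegral_congr_fun measurableSet_Ioi fun t ht => ?_
  have ht' : 0 < t := ht
  have e1 : -(x / 2 * t) - x ^ 2 / (4 * (x / 2 * t)) = x * bkX t := by
    unfold bkX
    field_simp
    ring
  have e2 : (s - 3) / 2 = (s - 1) / 2 - 1 := by ring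
  have e3 : (1 / 2 : ℝ) ^ ((s - 1) / 2) * x ^ ((s - 1) / 2) =
      x / 2 * (x / 2) ^ ((s - 1) / 2 - 1) := by
    rw [← Real.mul_rpow (by norm_num) hx.le, mul_comm (x / 2), ← Real.rpow_add_one hb.ne']
    ring_nf
  rw [e1, e2, e3, Real.mul_rpow hb.le ht'.le]
  ring

/-- The Bessel kernel is completely monotone on `(0, ∞)` with strict inequalities;
in particular it is strictly decreasing and strictly convex there. -/
theorem besselKernel_completely_monotone (s : ℝ) (hs : s ∈ Set.Ioo (0 : ℝ) 1) :
    ContDiffOn ℝ (⊤ : ℕ∞) (besselKernel s) (Set.Ioi (0 : ℝ)) ∧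
      (∀ (n : ℕ) (x : ℝ), 0 < x →
        0 < (-1 : ℝ) ^ n * iteratedDeriv n (besselKernel s) x) ∧
      StrictAntiOn (besselKernel s) (Set.Ioi (0 : ℝ)) ∧
      StrictConvexOn ℝ (Set.Ioi (0 : ℝ)) (besselKernel s) := by
  obtain ⟨h0, h1⟩ := hs
  have hG : 0 < Real.Gamma (s / 2) := Real.Gamma_pos_of_pos (by linarith)
  have hc : 0 < (1 / (2 * Real.sqrt Real.pi * Real.Gamma (s / 2))) *
      (1 / 2 : ℝ) ^ ((s - 1) / 2) := by
    have := Real.pi_pos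
    positivity
  have H : StrictCM (besselKernel s) :=
    (((strictCM_rpow ((s - 1) / 2) (by linarith)).mul
      (strictCM_mgf ((s - 1) / 2) (by linarith))).const_mul hc).congr fun x hx => bk_eq_s5 s hx
  have hcd : ContDiffOn ℝ (⊤ : ℕ∞) (besselKernel s) (Set.Ioi (0 : ℝ)) :=
    fun x hx => (H.1 x hx).contDiffWithinAt
  refine ⟨hcd, H.2, ?_, ?_⟩
  · refine strictAntiOn_of_deriv_neg (convex_Ioi 0) hcd.continuousOn fun x hx => ?_
    rw [interior_Ioi] at hx
    have := H.2 1 x hx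
    rw [iteratedDeriv_one] at this
    linarith
  · refine strictConvexOn_of_deriv2_pos (convex_Ioi 0) hcd.continuousOn fun x hx => ?_
    rw [interior_Ioi] at hx
    have := H.2 2 x hx
    rw [iteratedDeriv_eq_iterate] at this
    linarith
end

section
/- Let s ∈ (0,1) and P ∈ (0, ∞). For every x ∈ ℝ with x ∉ P·ℤ, the series K_{P,s}(x) = Σ_{n∈ℤ} K_s(x + nP) converges. The resulting function K_{P,s} is even, P-periodic, and strictly increasing on the interval (−P/2, 0). Moreover, there exist constants c, C, δ > 0 such that c·|x|^{s−1} ≤ K_{P,s}(x) ≤ C·|x|^{s−1} for all 0 < |x| ≤ δ. -/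
open MeasureTheory Set

/-- The periodic Bessel kernel `K_{P,s}`. -/
noncomputable def periodicBesselKernel (s P x : ℝ) : ℝ :=
  ∑' n : ℤ, besselKernel s (x + n * P)

/-- Auxiliary integral. -/
noncomputable def auxI (p a b : ℝ) : ℝ :=
  ∫ t in Set.Ioi (0 : ℝ), Real.exp (-(a * t) - b / t) * t ^ p

lemma aux_meas (p a b : ℝ) :
    Measurable (fun t : ℝ => Real.exp (-(a * t) - b / t) * t ^ p) := by
  fun_prop

lemma aux_int0 (p b : ℝ) (hp : p < -1) (hp' : -2 < p) (hb : 0 < b) :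
    IntegrableOn (fun t : ℝ => Real.exp (-(0 * t) - b / t) * t ^ p) (Set.Ioi 0) := by
  rw [← Set.Ioo_union_Ici_eq_Ioi (zero_lt_one : (0:ℝ) < 1)]
  apply IntegrableOn.union
  · have h1 : IntegrableOn (fun t : ℝ => (1 / b) * t ^ (p + 1)) (Set.Ioo 0 1) := by
      apply Integrable.const_mul
      exact (intervalIntegral.integrableOn_Ioo_rpow_iff zero_lt_one).2 (by linarith)
    refine Integrable.mono' h1 (aux_meas p 0 b).aestronglyMeasurable ?_
    refine (ae_restrict_mem measurableSet_Ioo).mono fun t ht => ?_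
    have ht0 : 0 < t := ht.1
    rw [Real.norm_of_nonneg (by positivity), Real.rpow_add_one ht0.ne']
    have h2 : Real.exp (-(0 * t) - b / t) ≤ t / b := by
      have h3 : -(0 * t) - b / t = -(b / t) := by ring
      rw [h3, Real.exp_neg]
      have h4 : b / t ≤ Real.exp (b / t) := by
        have := Real.add_one_le_exp (b / t); linarith
      have h5 : 0 < b / t := by positivity
      calc (Real.exp (b / t))⁻¹ ≤ (b / t)⁻¹ := inv_anti₀ h5 h4
        _ = t / b := by rw [inv_div]
    calc _ ≤ t / b * t ^ p := by gcongr
      _ = _ := by ring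
  · have h1 : IntegrableOn (fun t : ℝ => t ^ p) (Set.Ici 1) := by
      rw [integrableOn_Ici_iff_integrableOn_Ioi]
      exact integrableOn_Ioi_rpow_of_lt hp zero_lt_one
    refine Integrable.mono' h1 (aux_meas p 0 b).aestronglyMeasurable ?_
    refine (ae_restrict_mem measurableSet_Ici).mono fun t ht => ?_
    have ht0 : 0 < t := lt_of_lt_of_le zero_lt_one ht
    rw [Real.norm_of_nonneg (by positivity)]
    have h2 : Real.exp (-(0 * t) - b / t) ≤ 1 := by
      rw [Real.exp_le_one_iff]
      have h5 : 0 < b / t := by positivity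
      linarith
    calc _ ≤ 1 * t ^ p := by gcongr
      _ = _ := by ring

lemma aux_int (p a b : ℝ) (hp : p < -1) (hp' : -2 < p) (ha : 0 ≤ a) (hb : 0 < b) :
    IntegrableOn (fun t : ℝ => Real.exp (-(a * t) - b / t) * t ^ p) (Set.Ioi 0) := by
  refine Integrable.mono' (aux_int0 p b hp hp' hb) (aux_meas p a b).aestronglyMeasurable ?_
  refine (ae_restrict_mem measurableSet_Ioi).mono fun t ht => ?_
  have ht0 : 0 < t := ht
  rw [Real.norm_of_nonneg (by positivity)]
  gcongr

lemma auxI_pos (p a b : ℝ) (hp : p < -1) (hp' : -2 < p) (ha : 0 ≤ a) (hb : 0 < b) :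
    0 < auxI p a b := by
  unfold auxI
  have hnn : 0 ≤ᵐ[volume.restrict (Set.Ioi 0)]
      (fun t : ℝ => Real.exp (-(a * t) - b / t) * t ^ p) := by
    refine (ae_restrict_mem measurableSet_Ioi).mono fun t ht => ?_
    have ht0 : 0 < t := ht
    simp only [Pi.zero_apply]
    positivity
  rw [setIntegral_pos_iff_support_of_nonneg_ae hnn (aux_int p a b hp hp' ha hb)]
  have : Set.Ioi (0:ℝ) ⊆
      (Function.support fun t : ℝ => Real.exp (-(a * t) - b / t) * t ^ p) ∩ Set.Ioi 0 := by
    intro t ht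
    have ht0 : 0 < t := ht
    exact ⟨by simp only [Function.mem_support]; positivity, ht⟩
  refine lt_of_lt_of_le ?_ (measure_mono this)
  simp

lemma auxI_mono (p a a' b b' : ℝ) (hp : p < -1) (hp' : -2 < p) (ha : 0 ≤ a) (hb : 0 < b)
    (haa : a ≤ a') (hbb : b ≤ b') : auxI p a' b' ≤ auxI p a b := by
  unfold auxI
  refine setIntegral_mono_on (aux_int p a' b' hp hp' (by linarith) (by linarith))
    (aux_int p a b hp hp' ha hb) measurableSet_Ioi fun t ht => ?_
  have ht0 : 0 < t := ht
  gcongr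

/-- scaling -/
lemma auxI_scale (p a b c : ℝ) (hc : 0 < c) :
    auxI p a b = c ^ (p + 1) * auxI p (a * c) (b / c) := by
  unfold auxI
  have h := integral_comp_mul_left_Ioi
    (fun t : ℝ => Real.exp (-(a * t) - b / t) * t ^ p) 0 hc
  rw [mul_zero] at h
  have h2 : ∫ t in Set.Ioi (0 : ℝ), Real.exp (-(a * t) - b / t) * t ^ p =
      c * ∫ t in Set.Ioi (0 : ℝ), Real.exp (-(a * (c * t)) - b / (c * t)) * (c * t) ^ p := by
    rw [h, smul_eq_mul, ← mul_assoc, mul_inv_cancel₀ hc.ne', one_mul]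
  rw [h2, Real.rpow_add_one hc.ne', mul_comm (c ^ p) c, mul_assoc, ← integral_const_mul (c ^ p)]
  congr 1
  refine setIntegral_congr_fun measurableSet_Ioi fun t ht => ?_
  have ht0 : 0 < t := ht
  rw [Real.mul_rpow hc.le ht0.le]
  have : -(a * (c * t)) - b / (c * t) = -(a * c * t) - b / c / t := by
    field_simp
  rw [this]; ring

/-- unnormalised kernel -/
noncomputable def auxG (p x : ℝ) : ℝ := auxI p 1 (x ^ 2 / 4)

lemma auxG_neg (p x : ℝ) : auxG p (-x) = auxG p x := by simp [auxG]

lemma bessel_eq (s x : ℝ) : besselKernel s x =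
    (1 / (2 * Real.sqrt Real.pi * Real.Gamma (s / 2))) * auxG ((s - 3) / 2) x := by
  unfold besselKernel auxG auxI
  congr 1
  refine setIntegral_congr_fun measurableSet_Ioi fun t ht => ?_
  have ht0 : 0 < t := ht
  congr 2
  field_simp

/-- `G x = x^(p+1) * H x`. -/
lemma auxG_eq (p x : ℝ) (hx : 0 < x) : auxG p x = x ^ (p + 1) * auxI p x (x / 4) := by
  unfold auxG
  rw [auxI_scale p 1 _ x hx]
  congr 2
  · ring
  · field_simp

lemma auxG_eq2 (p x : ℝ) (hx : 0 < x) :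
    auxG p x = x ^ (2 * (p + 1)) * auxI p (x ^ 2) (1 / 4) := by
  unfold auxG
  rw [auxI_scale p 1 _ (x ^ 2) (by positivity)]
  congr 1
  · rw [← Real.rpow_natCast, ← Real.rpow_mul hx.le]; norm_num
  · congr 1
    · ring
    · field_simp

lemma auxG_pos (p x : ℝ) (hp : p < -1) (hp' : -2 < p) (hx : 0 < x) : 0 < auxG p x :=
  auxI_pos p _ _ hp hp' zero_le_one (by positivity)

lemma auxG_anti (p x y : ℝ) (hp : p < -1) (hp' : -2 < p) (hx : 0 < x) (hxy : x ≤ y) :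
    auxG p y ≤ auxG p x :=
  auxI_mono p _ _ _ _ hp hp' zero_le_one (by positivity) le_rfl (by gcongr)

/-- exponential decay -/
lemma auxG_decay (p x y : ℝ) (hp : p < -1) (hp' : -2 < p) (hx : 0 < x) (hxy : x ≤ y) :
    auxG p y ≤ Real.exp (-(y - x)) * auxG p x := by
  have hy : 0 < y := hx.trans_le hxy
  rw [auxG_eq p x hx, auxG_eq p y hy]
  have h1 : y ^ (p + 1) ≤ x ^ (p + 1) :=
    Real.rpow_le_rpow_of_nonpos hx hxy (by linarith)
  have h2 : auxI p y (y / 4) ≤ Real.exp (-(y - x)) * auxI p x (x / 4) := by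
    unfold auxI
    rw [← integral_const_mul]
    refine setIntegral_mono_on (aux_int p _ _ hp hp' (by linarith) (by linarith))
      ((aux_int p _ _ hp hp' (by linarith) (by linarith)).const_mul _)
      measurableSet_Ioi fun t ht => ?_
    have ht0 : 0 < t := ht
    rw [← mul_assoc, ← Real.exp_add]
    gcongr
    have h3 : 1 ≤ t + 1 / (4 * t) := by
      rw [← sub_nonneg]
      have : t + 1 / (4 * t) - 1 = (2 * t - 1) ^ 2 / (4 * t) := by
        field_simp; ring
      rw [this]; positivity
    have h4 : -(y - x) + (-(x * t) - x / 4 / t) - (-(y * t) - y / 4 / t)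
        = (y - x) * (t + 1 / (4 * t) - 1) := by
      field_simp; ring
    have h5 : 0 ≤ (y - x) * (t + 1 / (4 * t) - 1) :=
      mul_nonneg (by linarith) (by linarith)
    linarith
  have h6 := (auxI_pos p y (y / 4) hp hp' (by linarith) (by linarith)).le
  calc _ ≤ x ^ (p + 1) * (Real.exp (-(y - x)) * auxI p x (x / 4)) := by gcongr
    _ = _ := by ring

lemma auxH_convex (p x y a b : ℝ) (hp : p < -1) (hp' : -2 < p) (hx : 0 < x) (hy : 0 < y)
    (ha : 0 < a) (hb : 0 < b) (hab : a + b = 1) :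
    auxI p (a * x + b * y) ((a * x + b * y) / 4) ≤
      a * auxI p x (x / 4) + b * auxI p y (y / 4) := by
  have hz : 0 < a * x + b * y := by positivity
  unfold auxI
  rw [← integral_const_mul, ← integral_const_mul, ← integral_add]
  rotate_left
  · exact ((aux_int p _ _ hp hp' (by linarith) (by linarith)).const_mul _)
  · exact ((aux_int p _ _ hp hp' (by linarith) (by linarith)).const_mul _)
  refine setIntegral_mono_on (aux_int p _ _ hp hp' (by linarith) (by linarith))
      (((aux_int p _ _ hp hp' (by linarith) (by linarith)).const_mul _).add
      ((aux_int p _ _ hp hp' (by linarith) (by linarith)).const_mul _))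
      measurableSet_Ioi fun t ht => ?_
  have ht0 : 0 < t := ht
  have h := convexOn_exp.2 (Set.mem_univ (-(x * t) - x / 4 / t))
    (Set.mem_univ (-(y * t) - y / 4 / t)) ha.le hb.le hab
  simp only [smul_eq_mul] at h
  have h2 : -((a * x + b * y) * t) - (a * x + b * y) / 4 / t =
    a * (-(x * t) - x / 4 / t) + b * (-(y * t) - y / 4 / t) := by ring
  rw [h2]
  calc _ ≤ (a * Real.exp (-(x * t) - x / 4 / t) + b * Real.exp (-(y * t) - y / 4 / t)) * t ^ p := by
        gcongr
    _ = _ := by ring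

lemma aux_rpow_convex (q x y a b : ℝ) (hq : q < 0) (hx : 0 < x) (hxy : x < y)
    (ha : 0 < a) (hb : 0 < b) (hab : a + b = 1) :
    (a * x + b * y) ^ q < a * x ^ q + b * y ^ q := by
  have hy : 0 < y := hx.trans hxy
  have hz : 0 < a * x + b * y := by positivity
  have h1 := strictConcaveOn_log_Ioi.2 (Set.mem_Ioi.2 hx) (Set.mem_Ioi.2 hy) hxy.ne ha hb hab
  simp only [smul_eq_mul] at h1
  have h := convexOn_exp.2 (Set.mem_univ (Real.log x * q))
    (Set.mem_univ (Real.log y * q)) ha.le hb.le hab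
  simp only [smul_eq_mul] at h
  rw [Real.rpow_def_of_pos hx, Real.rpow_def_of_pos hy, Real.rpow_def_of_pos hz]
  refine lt_of_lt_of_le (Real.exp_lt_exp.2 ?_) h
  nlinarith

lemma auxG_convex (p x y a b : ℝ) (hp : p < -1) (hp' : -2 < p) (hx : 0 < x) (hxy : x < y)
    (ha : 0 < a) (hb : 0 < b) (hab : a + b = 1) :
    auxG p (a * x + b * y) < a * auxG p x + b * auxG p y := by
  have hy : 0 < y := hx.trans hxy
  have hz : 0 < a * x + b * y := by positivity
  rw [auxG_eq p x hx, auxG_eq p y hy, auxG_eq p _ hz]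
  have h1 := aux_rpow_convex (p + 1) x y a b (by linarith) hx hxy ha hb hab
  have h2 := auxH_convex p x y a b hp hp' hx hy ha hb hab
  have h3 := auxI_pos p _ _ hp hp' hz.le (by linarith : 0 < (a * x + b * y) / 4)
  have h4 : auxI p y (y / 4) ≤ auxI p x (x / 4) :=
    auxI_mono p _ _ _ _ hp hp' (by linarith) (by linarith) (by linarith) (by linarith)
  have h5 : y ^ (p + 1) ≤ x ^ (p + 1) :=
    Real.rpow_le_rpow_of_nonpos hx hxy.le (by linarith)
  have h6 : 0 < a * x ^ (p + 1) + b * y ^ (p + 1) := by positivity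
  generalize auxI p (a * x + b * y) ((a * x + b * y) / 4) = Hz at *
  generalize auxI p x (x / 4) = Hx at *
  generalize auxI p y (y / 4) = Hy at *
  generalize (a * x + b * y) ^ (p + 1) = fz at *
  generalize x ^ (p + 1) = fx at *
  generalize y ^ (p + 1) = fy at *
  have hb' : b = 1 - a := by linarith
  calc fz * Hz < (a * fx + b * fy) * Hz := by gcongr
    _ ≤ (a * fx + b * fy) * (a * Hx + b * Hy) := by gcongr
    _ = a * (fx * Hx) + b * (fy * Hy) - a * b * ((fx - fy) * (Hx - Hy)) := by
        subst hb'; ring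
    _ ≤ _ := by
        have : 0 ≤ a * b * ((fx - fy) * (Hx - Hy)) :=
          mul_nonneg (by positivity) (mul_nonneg (by linarith) (by linarith))
        linarith

lemma auxG_four (p u v w z : ℝ) (hp : p < -1) (hp' : -2 < p) (hu : 0 < u) (huv : u < v)
    (hvz : v < z) (hsum : u + z = v + w) :
    auxG p v + auxG p w < auxG p u + auxG p z := by
  have hd : 0 < z - u := by linarith
  have ha : 0 < (z - v) / (z - u) := div_pos (by linarith) hd
  have hb : 0 < (v - u) / (z - u) := div_pos (by linarith) hd
  have hab : (z - v) / (z - u) + (v - u) / (z - u) = 1 := by field_simp; ring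
  have h1 := auxG_convex p u z _ _ hp hp' hu (by linarith) ha hb hab
  have h2 := auxG_convex p u z _ _ hp hp' hu (by linarith) hb ha (by linarith)
  have e1 : (z - v) / (z - u) * u + (v - u) / (z - u) * z = v := by field_simp; ring
  have e2 : (v - u) / (z - u) * u + (z - v) / (z - u) * z = w := by
    have : w = u + z - v := by linarith
    rw [this]; field_simp; ring
  rw [e1] at h1
  rw [e2] at h2
  generalize (z - v) / (z - u) = a at *
  generalize (v - u) / (z - u) = b at *
  have hb' : b = 1 - a := by linarith
  subst hb'
  linarith

lemma auxG_summable_nat (p P y : ℝ) (hp : p < -1) (hp' : -2 < p) (hP : 0 < P) (hy : 0 < y) :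
    Summable (fun n : ℕ => auxG p (y + n * P)) ∧
    ∑' n : ℕ, auxG p (y + n * P) ≤ (∑' n : ℕ, Real.exp (-P) ^ n) * auxG p y := by
  have hgeo : Summable (fun n : ℕ => Real.exp (-P) ^ n) :=
    summable_geometric_of_lt_one (Real.exp_pos _).le (Real.exp_lt_one_iff.2 (by linarith))
  have hb : ∀ n : ℕ, auxG p (y + n * P) ≤ Real.exp (-P) ^ n * auxG p y := by
    intro n
    have hn : 0 ≤ (n : ℝ) * P := by positivity
    have := auxG_decay p y (y + n * P) hp hp' hy (by linarith)
    rwa [← Real.exp_nat_mul, show (n : ℝ) * -P = -(y + n * P - y) by ring]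
  have hs : Summable (fun n : ℕ => auxG p (y + n * P)) :=
    Summable.of_nonneg_of_le (fun n => (auxG_pos p _ hp hp' (by positivity)).le) hb
      (hgeo.mul_right _)
  refine ⟨hs, ?_⟩
  rw [← tsum_mul_right]
  exact hs.tsum_le_tsum hb (hgeo.mul_right _)

lemma auxG_int (p P y : ℝ) (hp : p < -1) (hp' : -2 < p) (hP : 0 < P) (hy : 0 < y)
    (hyP : y < P) :
    HasSum (fun n : ℤ => auxG p (y + n * P))
      (∑' n : ℕ, (auxG p (y + n * P) + auxG p (P - y + n * P))) := by
  have h1 := (auxG_summable_nat p P y hp hp' hP hy).1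
  have h2 := (auxG_summable_nat p P (P - y) hp hp' hP (by linarith)).1
  rw [h1.tsum_add h2]
  refine HasSum.of_nat_of_neg_add_one ?_ ?_
  · simpa using h1.hasSum
  · convert h2.hasSum using 2 with n
    rw [← auxG_neg]
    congr 1
    push_cast
    ring

/-- The periodized Bessel kernel is well defined, even, `P`-periodic, strictly increasing
on `(-P/2, 0)`, and behaves like `|x|^(s-1)` near the origin. -/
theorem periodicBesselKernel_properties (s P : ℝ) (hs : s ∈ Set.Ioo (0 : ℝ) 1)
    (hP : 0 < P) :
    (∀ x : ℝ, (∀ n : ℤ, x ≠ n * P) →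
      Summable (fun n : ℤ => besselKernel s (x + n * P))) ∧
    (∀ x : ℝ, (∀ n : ℤ, x ≠ n * P) →
      periodicBesselKernel s P (-x) = periodicBesselKernel s P x) ∧
    (∀ x : ℝ, (∀ n : ℤ, x ≠ n * P) →
      periodicBesselKernel s P (x + P) = periodicBesselKernel s P x) ∧
    StrictMonoOn (periodicBesselKernel s P) (Set.Ioo (-(P / 2)) 0) ∧
    (∃ c C δ, 0 < c ∧ 0 < C ∧ 0 < δ ∧
      ∀ x : ℝ, x ≠ 0 → |x| ≤ δ →
        c * |x| ^ (s - 1) ≤ periodicBesselKernel s P x ∧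
        periodicBesselKernel s P x ≤ C * |x| ^ (s - 1)) := by
  obtain ⟨hs0, hs1⟩ := hs
  obtain ⟨p, hpdef⟩ : ∃ p, p = (s - 3) / 2 := ⟨_, rfl⟩
  have hp : p < -1 := by linarith
  have hp' : -2 < p := by linarith
  obtain ⟨k, hk⟩ : ∃ k, k = 1 / (2 * Real.sqrt Real.pi * Real.Gamma (s / 2)) := ⟨_, rfl⟩
  have hk0 : 0 < k := by
    have := Real.Gamma_pos_of_pos (by linarith : 0 < s / 2)
    have := Real.pi_pos
    rw [hk]; positivity
  have hB : ∀ x, besselKernel s x = k * auxG p x := fun x => by rw [bessel_eq, hk, hpdef]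
  have hev : ∀ x, periodicBesselKernel s P (-x) = periodicBesselKernel s P x := by
    intro x
    unfold periodicBesselKernel
    rw [← (Equiv.neg ℤ).tsum_eq]
    congr 1
    ext n
    rw [hB, hB, ← auxG_neg]
    congr 2
    simp only [Equiv.neg_apply]
    push_cast
    ring
  have hper : ∀ y, 0 < y → y < P → periodicBesselKernel s P y =
      k * ∑' n : ℕ, (auxG p (y + n * P) + auxG p (P - y + n * P)) := by
    intro y hy hyP
    unfold periodicBesselKernel
    simp only [hB]
    exact ((auxG_int p P y hp hp' hP hy hyP).mul_left k).tsum_eq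
  have hsm : ∀ y, 0 < y → y < P →
      Summable fun n : ℕ => (auxG p (y + n * P) + auxG p (P - y + n * P)) := fun y hy hyP =>
    (auxG_summable_nat p P y hp hp' hP hy).1.add
      (auxG_summable_nat p P (P - y) hp hp' hP (by linarith)).1
  refine ⟨?_, fun x _ => hev x, ?_, ?_, ?_⟩
  · intro x hx
    obtain ⟨m, hm, -⟩ := existsUnique_sub_zsmul_mem_Ico hP x 0
    simp only [zsmul_eq_mul, zero_add] at hm
    have hm0 : 0 < x - m * P := lt_of_le_of_ne hm.1 (fun h => hx m (by linarith))
    have h := ((auxG_int p P _ hp hp' hP hm0 hm.2).mul_left k).summable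
    rw [← (Equiv.addRight m).summable_iff] at h
    refine h.congr fun n => ?_
    simp only [Function.comp, Equiv.coe_addRight, hB]
    congr 2
    push_cast
    ring
  · intro x _
    unfold periodicBesselKernel
    rw [← (Equiv.addRight (1 : ℤ)).tsum_eq (fun n : ℤ => besselKernel s (x + n * P))]
    congr 1
    ext n
    congr 1
    simp only [Equiv.coe_addRight]
    push_cast
    ring
  · intro x hx y hy hxy
    obtain ⟨hx1, hx2⟩ := hx
    obtain ⟨hy1, hy2⟩ := hy
    rw [← hev x, ← hev y, hper (-x) (by linarith) (by linarith),
      hper (-y) (by linarith) (by linarith)]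
    have key : ∀ n : ℕ, auxG p (-x + n * P) + auxG p (P - -x + n * P) <
        auxG p (-y + n * P) + auxG p (P - -y + n * P) := by
      intro n
      have hn : 0 ≤ (n : ℝ) * P := by positivity
      exact auxG_four p _ _ _ _ hp hp' (by linarith) (by linarith) (by linarith) (by ring)
    have := Summable.tsum_lt_tsum (i := 0) (fun n => (key n).le) (key 0)
      (hsm (-x) (by linarith) (by linarith)) (hsm (-y) (by linarith) (by linarith))
    gcongr
  · obtain ⟨S, hS⟩ : ∃ S, S = ∑' n : ℕ, Real.exp (-P) ^ n := ⟨_, rfl⟩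
    have hS0 : 0 < S := by
      rw [hS, tsum_geometric_of_lt_one (Real.exp_pos _).le (Real.exp_lt_one_iff.2 (by linarith))]
      have := Real.exp_lt_one_iff.2 (by linarith : -P < 0)
      exact inv_pos.2 (by linarith)
    have hI1 := auxI_pos p 1 (1 / 4) hp hp' zero_le_one (by norm_num)
    have hI0 := auxI_pos p 0 (1 / 4) hp hp' le_rfl (by norm_num)
    refine ⟨k * auxI p 1 (1 / 4), k * (2 * S * auxI p 0 (1 / 4)), min 1 (P / 2),
      by positivity, by positivity, by positivity, ?_⟩
    intro x hx0 hxd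
    have hy0 : 0 < |x| := abs_pos.2 hx0
    have hy1 : |x| ≤ 1 := hxd.trans (min_le_left _ _)
    have hyP : |x| ≤ P / 2 := hxd.trans (min_le_right _ _)
    have hxabs : periodicBesselKernel s P x = periodicBesselKernel s P |x| := by
      rcases abs_choice x with h | h
      · rw [h]
      · rw [h, hev]
    rw [hxabs]
    generalize |x| = y at *
    rw [hper y hy0 (by linarith)]
    have hG := auxG_eq2 p y hy0
    have he : 2 * (p + 1) = s - 1 := by rw [hpdef]; ring
    rw [he] at hG
    have hypos : 0 < y ^ (s - 1) := by positivity
    constructor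
    · have h1 := (hsm y hy0 (by linarith)).le_tsum 0 (fun n _ => by
        have hn : 0 ≤ (n : ℝ) * P := by positivity
        exact add_nonneg (auxG_pos p _ hp hp' (by linarith)).le
          (auxG_pos p _ hp hp' (by linarith)).le)
      simp only [Nat.cast_zero, zero_mul, add_zero] at h1
      have h2 := auxG_pos p (P - y) hp hp' (by linarith)
      have h3 : auxI p 1 (1 / 4) ≤ auxI p (y ^ 2) (1 / 4) :=
        auxI_mono p _ _ _ _ hp hp' (by positivity) (by norm_num)
          (pow_le_one₀ hy0.le hy1) le_rfl
      have h4 : y ^ (s - 1) * auxI p 1 (1 / 4) ≤ auxG p y := by rw [hG]; gcongr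
      rw [mul_assoc]
      gcongr
      linarith
    · have h1 := auxG_summable_nat p P y hp hp' hP hy0
      have h2 := auxG_summable_nat p P (P - y) hp hp' hP (by linarith)
      rw [h1.1.tsum_add h2.1]
      have h3 : auxG p (P - y) ≤ auxG p y := auxG_anti p _ _ hp hp' hy0 (by linarith)
      have h4 : auxI p (y ^ 2) (1 / 4) ≤ auxI p 0 (1 / 4) :=
        auxI_mono p _ _ _ _ hp hp' le_rfl (by norm_num) (by positivity) le_rfl
      have h5 : auxG p y ≤ y ^ (s - 1) * auxI p 0 (1 / 4) := by rw [hG]; gcongr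
      have h6 := h1.2
      have h7 := h2.2
      rw [← hS] at h6 h7
      have h8 : S * auxG p (P - y) ≤ S * auxG p y := by gcongr
      have h9 : S * auxG p y ≤ S * (y ^ (s - 1) * auxI p 0 (1 / 4)) := by gcongr
      rw [mul_assoc]
      gcongr
      linarith
end

section
/- Let s ∈ (0,1). There exists an even, nonnegative, integrable function Φ_s : ℝ → ℝ with ∫_ℝ Φ_s(x) dx = 1 whose Fourier transform equals the symbol m(ξ) = 4/(3 + (1 + ξ²)^{s/2}); that is, ∫_ℝ Φ_s(x)·e^{−i x ξ} dx = 4/(3 + (1 + ξ²)^{s/2}) for all ξ ∈ ℝ. -/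
open MeasureTheory Set

lemma ft_exp_abs (a : ℝ) (ha : 0 < a) (ξ : ℝ) :
    Integrable (fun x : ℝ => ((Real.exp (-(a * |x|)) : ℝ) : ℂ) * Complex.exp (-(Complex.I * x * ξ))) ∧
    (∫ x : ℝ, ((Real.exp (-(a * |x|)) : ℝ) : ℂ) * Complex.exp (-(Complex.I * x * ξ)))
      = ((2 * a / (a ^ 2 + ξ ^ 2) : ℝ) : ℂ) := by
  set f : ℝ → ℂ := fun x : ℝ => ((Real.exp (-(a * |x|)) : ℝ) : ℂ) * Complex.exp (-(Complex.I * x * ξ)) with hf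
  have e1 : ∀ x ∈ Ioi (0:ℝ), Complex.exp ((-a - Complex.I * ξ : ℂ) * x) = f x := by
    intro x hx
    have hx' : (0:ℝ) < x := hx
    simp only [hf, abs_of_pos hx']
    push_cast
    rw [← Complex.exp_add]
    congr 1; ring
  have e2 : ∀ x ∈ Iic (0:ℝ), Complex.exp ((a - Complex.I * ξ : ℂ) * x) = f x := by
    intro x hx
    have hx' : x ≤ 0 := hx
    simp only [hf, abs_of_nonpos hx']
    push_cast
    rw [← Complex.exp_add]
    congr 1; ring
  have r1 : (-a - Complex.I * ξ : ℂ).re < 0 := by simp [ha]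
  have r2 : 0 < (a - Complex.I * ξ : ℂ).re := by simp [ha]
  have i1 : IntegrableOn f (Ioi 0) :=
    (integrableOn_exp_mul_complex_Ioi r1 0).congr_fun e1 measurableSet_Ioi
  have i2 : IntegrableOn f (Iic 0) :=
    (integrableOn_exp_mul_complex_Iic r2 0).congr_fun e2 measurableSet_Iic
  have hi : Integrable f := by
    rw [← integrableOn_univ, ← Iic_union_Ioi (a := (0:ℝ))]
    exact i2.union i1
  refine ⟨hi, ?_⟩
  rw [← intervalIntegral.integral_Iic_add_Ioi i2 i1, ← setIntegral_congr_fun measurableSet_Ioi e1,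
    ← setIntegral_congr_fun measurableSet_Iic e2, integral_exp_mul_complex_Ioi r1,
    integral_exp_mul_complex_Iic r2]
  have n1 : (-a - Complex.I * ξ : ℂ) ≠ 0 := fun h => by rw [h] at r1; simp at r1
  have n2 : (a - Complex.I * ξ : ℂ) ≠ 0 := fun h => by rw [h] at r2; simp at r2
  have n3 : ((a:ℂ) ^ 2 + (ξ:ℂ) ^ 2) ≠ 0 := by
    have : a ^ 2 + ξ ^ 2 ≠ 0 := by positivity
    exact_mod_cast this
  push_cast
  simp only [mul_zero, Complex.exp_zero]
  field_simp
  ring_nf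
  simp only [Complex.I_sq]
  ring

lemma int_exp_abs (a : ℝ) (ha : 0 < a) :
    Integrable (fun x : ℝ => Real.exp (-(a * |x|))) ∧
    (∫ x : ℝ, Real.exp (-(a * |x|))) = 2 / a := by
  obtain ⟨h1, h2⟩ := ft_exp_abs a ha 0
  simp only [Complex.ofReal_zero, mul_zero, neg_zero, Complex.exp_zero, mul_one] at h1 h2
  refine ⟨h1.re, ?_⟩
  rw [integral_complex_ofReal] at h2
  have := Complex.ofReal_injective h2
  rw [this]
  field_simp
  simp

/-- Stieltjes density (in logarithmic variable) -/
noncomputable def stW (σ y : ℝ) : ℝ :=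
  (4 / Real.pi) * (Real.exp (σ * y) * Real.sin (Real.pi * σ)) /
    ((3 + Real.exp (σ * y) * Real.cos (Real.pi * σ)) ^ 2
      + (Real.exp (σ * y) * Real.sin (Real.pi * σ)) ^ 2)

lemma stW_den (σ y : ℝ) (h0 : 0 < σ) (h1 : σ < 1 / 2) :
    9 + Real.exp (σ * y) ^ 2 ≤ ((3 + Real.exp (σ * y) * Real.cos (Real.pi * σ)) ^ 2
      + (Real.exp (σ * y) * Real.sin (Real.pi * σ)) ^ 2) := by
  have hp := Real.pi_pos
  have hc : 0 ≤ Real.cos (Real.pi * σ) :=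
    Real.cos_nonneg_of_neg_pi_div_two_le_of_le (by nlinarith) (by nlinarith)
  have := Real.sin_sq_add_cos_sq (Real.pi * σ)
  have he := Real.exp_pos (σ * y)
  have h3 : 0 ≤ Real.exp (σ * y) * Real.cos (Real.pi * σ) := by positivity
  have : (Real.exp (σ * y) * Real.sin (Real.pi * σ)) ^ 2 + (Real.exp (σ * y) * Real.cos (Real.pi * σ)) ^ 2
    = Real.exp (σ * y) ^ 2 := by rw [mul_pow, mul_pow, ← mul_add, this, mul_one]
  nlinarith

lemma stW_nonneg (σ y : ℝ) (h0 : 0 < σ) (h1 : σ < 1 / 2) : 0 ≤ stW σ y := by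
  have hp := Real.pi_pos
  have hs : 0 ≤ Real.sin (Real.pi * σ) :=
    Real.sin_nonneg_of_nonneg_of_le_pi (by positivity) (by nlinarith)
  unfold stW; positivity

lemma stW_cont (σ : ℝ) (h0 : 0 < σ) (h1 : σ < 1 / 2) : Continuous (stW σ) := by
  unfold stW
  refine Continuous.div (by fun_prop) (by fun_prop) ?_
  intro y
  have := stW_den σ y h0 h1
  have := sq_nonneg (Real.exp (σ * y))
  linarith

lemma stW_le (σ y : ℝ) (h0 : 0 < σ) (h1 : σ < 1 / 2) :
    stW σ y ≤ 2 * Real.exp (-(σ * |y|)) := by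
  have hp := Real.pi_gt_three
  have hD := stW_den σ y h0 h1
  have he := Real.exp_pos (σ * y)
  have hs : Real.sin (Real.pi * σ) ≤ 1 := Real.sin_le_one _
  have h4 : 4 / Real.pi ≤ 2 := by rw [div_le_iff₀ (by linarith)]; linarith
  have hpos : 0 < 9 + Real.exp (σ * y) ^ 2 := by positivity
  unfold stW
  rw [div_le_iff₀ (lt_of_lt_of_le hpos hD)]
  have key : Real.exp (σ * y) ≤ Real.exp (-(σ * |y|)) * (9 + Real.exp (σ * y) ^ 2) := by
    rcases le_total 0 y with h | h
    · rw [abs_of_nonneg h, Real.exp_neg]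
      rw [inv_mul_eq_div, le_div_iff₀ he]; nlinarith
    · rw [abs_of_nonpos h]
      have : -(σ * -y) = σ * y := by ring
      rw [this]; nlinarith
  have hsn : 0 ≤ Real.sin (Real.pi * σ) :=
    Real.sin_nonneg_of_nonneg_of_le_pi (by positivity) (by nlinarith)
  calc (4 / Real.pi) * (Real.exp (σ * y) * Real.sin (Real.pi * σ))
      ≤ 2 * (Real.exp (σ * y) * 1) := by gcongr
    _ ≤ 2 * (Real.exp (-(σ * |y|)) * (9 + Real.exp (σ * y) ^ 2)) := by rw [mul_one]; gcongr
    _ = 2 * Real.exp (-(σ * |y|)) * (9 + Real.exp (σ * y) ^ 2) := by ring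
    _ ≤ _ := by gcongr

lemma stW_integrable (σ lam : ℝ) (h0 : 0 < σ) (h1 : σ < 1 / 2) (hl : 0 < lam) :
    Integrable (fun y => stW σ y * (Real.exp y / (Real.exp y + lam))) := by
  have hc := stW_cont σ h0 h1
  refine Integrable.mono' ((int_exp_abs σ h0).1.const_mul 2) ?_ ?_
  · apply Continuous.aestronglyMeasurable
    refine hc.mul (Continuous.div (by fun_prop) (by fun_prop) ?_)
    intro y; positivity
  · refine Filter.Eventually.of_forall fun y => ?_
    have hn := stW_nonneg σ y h0 h1
    rw [Real.norm_of_nonneg (by positivity)]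
    refine le_trans ?_ (stW_le σ y h0 h1)
    apply mul_le_of_le_one_right hn
    rw [div_le_one (by positivity)]; linarith

noncomputable def stF (σ : ℝ) (z : ℂ) : ℂ := 4 / (3 + Complex.exp (σ * z))

lemma stF_den_re (σ : ℝ) (h0 : 0 < σ) (h1 : σ < 1 / 2) (z : ℂ) (hz : |z.im| ≤ Real.pi) :
    3 ≤ (3 + Complex.exp (σ * z)).re := by
  have hp := Real.pi_pos
  obtain ⟨ha, hb⟩ := abs_le.mp hz
  have hc : 0 ≤ Real.cos (σ * z.im) :=
    Real.cos_nonneg_of_neg_pi_div_two_le_of_le (by nlinarith) (by nlinarith)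
  have : 0 ≤ (Complex.exp (σ * z)).re := by
    rw [Complex.exp_re]
    simp only [Complex.mul_re, Complex.mul_im, Complex.ofReal_re, Complex.ofReal_im, zero_mul,
      add_zero, sub_zero]
    positivity
  simp only [Complex.add_re, Complex.re_ofNat]
  linarith

lemma stF_den_ne (σ : ℝ) (h0 : 0 < σ) (h1 : σ < 1 / 2) (z : ℂ) (hz : |z.im| ≤ Real.pi) :
    3 + Complex.exp (σ * z) ≠ 0 := by
  intro h
  have := stF_den_re σ h0 h1 z hz
  rw [h] at this
  norm_num at this

lemma stF_norm_le (σ : ℝ) (h0 : 0 < σ) (h1 : σ < 1 / 2) (z : ℂ) (hz : |z.im| ≤ Real.pi) :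
    ‖stF σ z‖ ≤ 2 := by
  have h := stF_den_re σ h0 h1 z hz
  have h2 := Complex.re_le_norm (3 + Complex.exp (σ * z))
  unfold stF
  rw [norm_div, div_le_iff₀ (by linarith)]
  norm_num
  linarith

lemma stF_diff (σ : ℝ) (h0 : 0 < σ) (h1 : σ < 1 / 2) (z : ℂ) (hz : |z.im| ≤ Real.pi) :
    DifferentiableAt ℂ (stF σ) z := by
  unfold stF
  refine DifferentiableAt.div (by fun_prop) (by fun_prop) (stF_den_ne σ h0 h1 z hz)

lemma stF_jump (σ : ℝ) (h0 : 0 < σ) (h1 : σ < 1 / 2) (x : ℝ) :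
    stF σ (x + ((-Real.pi : ℝ) : ℂ) * Complex.I) - stF σ (x + (Real.pi : ℂ) * Complex.I)
      = 2 * Real.pi * Complex.I * (stW σ x : ℂ) := by
  have hp := Real.pi_pos
  have n1 := stF_den_ne σ h0 h1 (x + ((-Real.pi : ℝ) : ℂ) * Complex.I) (by simp [abs_of_pos hp])
  have n2 := stF_den_ne σ h0 h1 (x + (Real.pi : ℂ) * Complex.I) (by simp [abs_of_pos hp])
  have hD := stW_den σ x h0 h1
  have e1 : Complex.exp (σ * (x + ((-Real.pi : ℝ) : ℂ) * Complex.I)) =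
      (Real.exp (σ * x) : ℂ) * (Real.cos (Real.pi * σ) - Real.sin (Real.pi * σ) * Complex.I) := by
    have : (σ * (x + ((-Real.pi : ℝ) : ℂ) * Complex.I) : ℂ)
      = ((σ * x : ℝ) : ℂ) + ((-(Real.pi * σ) : ℝ) : ℂ) * Complex.I := by push_cast; ring
    rw [this, Complex.exp_add, Complex.exp_mul_I, ← Complex.ofReal_cos, ← Complex.ofReal_sin,
      Real.cos_neg, Real.sin_neg, ← Complex.ofReal_exp]
    push_cast; ring
  have e2 : Complex.exp (σ * (x + (Real.pi : ℂ) * Complex.I)) =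
      (Real.exp (σ * x) : ℂ) * (Real.cos (Real.pi * σ) + Real.sin (Real.pi * σ) * Complex.I) := by
    have : (σ * (x + (Real.pi : ℂ) * Complex.I) : ℂ)
      = ((σ * x : ℝ) : ℂ) + (((Real.pi * σ) : ℝ) : ℂ) * Complex.I := by push_cast; ring
    rw [this, Complex.exp_add, Complex.exp_mul_I, ← Complex.ofReal_cos, ← Complex.ofReal_sin,
      ← Complex.ofReal_exp]
  unfold stF stW
  rw [e1] at n1 ⊢
  rw [e2] at n2 ⊢
  set E := Real.exp (σ * x)
  set C := Real.cos (Real.pi * σ)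
  set S := Real.sin (Real.pi * σ)
  have hE : 0 ≤ E ^ 2 := sq_nonneg _
  have hDne : ((3 + E * C) ^ 2 + (E * S) ^ 2 : ℝ) ≠ 0 := by linarith
  have hfac : (((3 + E * C) ^ 2 + (E * S) ^ 2 : ℝ) : ℂ) =
      (3 + E * (C - S * Complex.I)) * (3 + E * (C + S * Complex.I)) := by
    push_cast
    linear_combination ((E:ℂ)^2 * S^2) * Complex.I_sq
  have hpc : (Real.pi : ℂ) ≠ 0 := by exact_mod_cast hp.ne'
  rw [Complex.ofReal_div, hfac]
  push_cast
  field_simp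
  ring

lemma exp_sub_ne (L : ℝ) (z : ℂ) (hz : |z.im| ≤ Real.pi) (hne : z ≠ L) :
    Complex.exp z - Complex.exp L ≠ 0 := by
  have hp := Real.pi_pos
  intro h
  rw [sub_eq_zero, Complex.exp_eq_exp_iff_exists_int] at h
  obtain ⟨n, hn⟩ := h
  have him : z.im = n * (2 * Real.pi) := by rw [hn]; simp
  obtain ⟨ha, hb⟩ := abs_le.mp hz
  rw [him] at ha hb
  have h1 : (n:ℝ) < 1 := by nlinarith
  have h2 : (-1:ℝ) < n := by nlinarith
  have h1' : n < 1 := by exact_mod_cast h1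
  have h2' : -1 < n := by exact_mod_cast h2
  have : n = 0 := by omega
  subst this
  apply hne; rw [hn]; simp

/-- The integrand of the contour integral. -/
noncomputable def stG (σ L : ℝ) (z : ℂ) : ℂ :=
  dslope (stF σ) L z * Complex.exp z / dslope Complex.exp L z

lemma stG_eq (σ L : ℝ) (z : ℂ) (hz : |z.im| ≤ Real.pi) (hne : z ≠ L) :
    stG σ L z = (stF σ z - stF σ L) * (Complex.exp z / (Complex.exp z - Complex.exp L)) := by
  have h := exp_sub_ne L z hz hne
  have h' : z - L ≠ 0 := sub_ne_zero.mpr hne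
  unfold stG
  rw [dslope_of_ne _ hne, dslope_of_ne _ hne, slope_def_field, slope_def_field]
  field_simp

lemma stG_diff (σ L : ℝ) (h0 : 0 < σ) (h1 : σ < 1 / 2) :
    DifferentiableOn ℂ (stG σ L) {z | |z.im| ≤ Real.pi} := by
  have hp := Real.pi_pos
  have hs : {z : ℂ | |z.im| ≤ Real.pi} ∈ nhds (L : ℂ) := by
    have hc : Continuous fun z : ℂ => |z.im| := by fun_prop
    have := (isOpen_lt hc continuous_const).mem_nhds
      (show (L : ℂ) ∈ {z : ℂ | |z.im| < Real.pi} by simpa using hp)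
    filter_upwards [this] with z hz using le_of_lt hz
  have d1 : DifferentiableOn ℂ (dslope (stF σ) L) {z | |z.im| ≤ Real.pi} :=
    (Complex.differentiableOn_dslope hs).2
      fun z hz => (stF_diff σ h0 h1 z hz).differentiableWithinAt
  have d2 : DifferentiableOn ℂ (dslope Complex.exp L) {z | |z.im| ≤ Real.pi} :=
    (Complex.differentiableOn_dslope hs).2 Complex.differentiable_exp.differentiableOn
  refine DifferentiableOn.div (d1.mul Complex.differentiable_exp.differentiableOn) d2 ?_
  intro z hz
  by_cases hne : z = L
  · subst hne
    rw [dslope_same, Complex.deriv_exp]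
    exact Complex.exp_ne_zero _
  · rw [dslope_of_ne _ hne, slope_def_field]
    exact div_ne_zero (exp_sub_ne L z hz hne) (sub_ne_zero.mpr hne)

open Filter Topology in
lemma stieltjes (σ L : ℝ) (h0 : 0 < σ) (h1 : σ < 1 / 2) :
    (∫ y : ℝ, stW σ y * (Real.exp y / (Real.exp y + Real.exp L)))
      = 4 / (3 + Real.exp (σ * L)) := by
  have hp := Real.pi_pos
  have hint := stW_integrable σ (Real.exp L) h0 h1 (Real.exp_pos L)
  set g : ℝ → ℝ := fun y => stW σ y * (Real.exp y / (Real.exp y + Real.exp L)) with hg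
  -- vertical sides stay in the strip
  have him : ∀ R θ : ℝ, θ ∈ uIcc (-Real.pi) Real.pi → |((R:ℂ) + θ * Complex.I).im| ≤ Real.pi := by
    intro R θ hθ
    rw [uIcc_of_le (by linarith)] at hθ
    simpa using abs_le.mpr hθ
  have hre : ∀ R θ : ℝ, ((R:ℂ) + θ * Complex.I).re = R := by intro R θ; simp
  have hnorm : ∀ R θ : ℝ, ‖Complex.exp ((R:ℂ) + θ * Complex.I)‖ = Real.exp R := by
    intro R θ; rw [Complex.norm_exp, hre]
  have hneL : ∀ R θ : ℝ, R ≠ L → ((R:ℂ) + θ * Complex.I) ≠ L := by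
    intro R θ hR h; apply hR
    have := congrArg Complex.re h
    simpa using this
  have hnL : ‖Complex.exp (L:ℂ)‖ = Real.exp L := by rw [Complex.norm_exp]; simp
  have hmeas : ∀ R : ℝ, AEStronglyMeasurable (fun θ : ℝ => stG σ L ((R:ℂ) + θ * Complex.I))
      (volume.restrict (uIoc (-Real.pi) Real.pi)) := by
    intro R
    have : ContinuousOn (fun θ : ℝ => stG σ L ((R:ℂ) + θ * Complex.I)) (uIcc (-Real.pi) Real.pi) :=
      (stG_diff σ L h0 h1).continuousOn.comp (by fun_prop) (fun θ hθ => him R θ hθ)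
    exact (this.mono uIoc_subset_uIcc).aestronglyMeasurable measurableSet_uIoc
  have hFd : ∀ z : ℂ, |z.im| ≤ Real.pi → ‖stF σ z - stF σ L‖ ≤ 4 := by
    intro z hz
    have a1 := stF_norm_le σ h0 h1 z hz
    have a2 := stF_norm_le σ h0 h1 L (by simpa using hp.le)
    have := norm_sub_le (stF σ z) (stF σ L)
    linarith
  have hlimE : Tendsto (fun R : ℝ => Real.exp R) atTop atTop := Real.tendsto_exp_atTop
  have hv : ∀ c : ℝ, 0 < c → ∀ θ : ℝ,
      Tendsto (fun R : ℝ => Complex.exp (-(c * ((R:ℂ) + θ * Complex.I)))) atTop (𝓝 0) := by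
    intro c hc θ
    rw [tendsto_zero_iff_norm_tendsto_zero]
    have e : ∀ R : ℝ, ‖Complex.exp (-(c * ((R:ℂ) + θ * Complex.I)))‖ = Real.exp (-(c * R)) := by
      intro R; rw [Complex.norm_exp]; simp
    simp only [e]
    exact Real.tendsto_exp_neg_atTop_nhds_zero.comp (tendsto_id.const_mul_atTop hc)
  -- right side
  have hR : Tendsto (fun R : ℝ => ∫ θ in (-Real.pi)..Real.pi, stG σ L ((R:ℂ) + θ * Complex.I)) atTop
      (𝓝 (∫ θ in (-Real.pi)..Real.pi, -stF σ L)) := by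
    refine intervalIntegral.tendsto_integral_filter_of_dominated_convergence (fun _ => 8) ?_ ?_ ?_ ?_
    · exact Eventually.of_forall hmeas
    · filter_upwards [hlimE.eventually_ge_atTop (2 * Real.exp L), eventually_gt_atTop L] with R h2 hRL
      refine Eventually.of_forall fun θ hθ => ?_
      have hz := him R θ (uIoc_subset_uIcc hθ)
      rw [stG_eq σ L _ hz (hneL R θ hRL.ne'), norm_mul, norm_div, hnorm]
      have hd : Real.exp R - Real.exp L ≤ ‖Complex.exp ((R:ℂ) + θ * Complex.I) - Complex.exp L‖ := by
        have := norm_sub_norm_le (Complex.exp ((R:ℂ) + θ * Complex.I)) (Complex.exp L)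
        rwa [hnorm, hnL] at this
      have hpos := Real.exp_pos L
      have : Real.exp R / ‖Complex.exp ((R:ℂ) + θ * Complex.I) - Complex.exp L‖ ≤ 2 := by
        rw [div_le_iff₀ (by linarith)]; linarith
      calc _ ≤ (4:ℝ) * 2 := by gcongr; exact hFd _ hz
        _ = 8 := by norm_num
    · exact intervalIntegrable_const
    · refine Eventually.of_forall fun θ hθ => ?_
      have l1 : Tendsto (fun R : ℝ => stF σ ((R:ℂ) + θ * Complex.I)) atTop (𝓝 0) := by
        have e : ∀ R : ℝ, stF σ ((R:ℂ) + θ * Complex.I) =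
            4 * Complex.exp (-(σ * ((R:ℂ) + θ * Complex.I))) /
              (3 * Complex.exp (-(σ * ((R:ℂ) + θ * Complex.I))) + 1) := by
          intro R
          unfold stF
          rw [← mul_div_mul_right 4 _ (Complex.exp_ne_zero (-(σ * ((R:ℂ) + θ * Complex.I)))), add_mul,
            ← Complex.exp_add, add_neg_cancel, Complex.exp_zero]
        simp only [e]
        have hu := hv σ h0 θ
        have := (hu.const_mul 4).div ((hu.const_mul 3).add_const 1) (by norm_num)
        simpa [Pi.div_def] using this
      have l2 : Tendsto (fun R : ℝ => Complex.exp ((R:ℂ) + θ * Complex.I) /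
          (Complex.exp ((R:ℂ) + θ * Complex.I) - Complex.exp L)) atTop (𝓝 1) := by
        have e : ∀ R : ℝ, Complex.exp ((R:ℂ) + θ * Complex.I) /
          (Complex.exp ((R:ℂ) + θ * Complex.I) - Complex.exp L) =
            1 / (1 - Complex.exp L * Complex.exp (-(((1:ℝ):ℂ) * ((R:ℂ) + θ * Complex.I)))) := by
          intro R
          rw [← mul_div_mul_right _ _ (Complex.exp_ne_zero (-(((1:ℝ):ℂ) * ((R:ℂ) + θ * Complex.I)))), sub_mul,
            ← Complex.exp_add, Complex.ofReal_one, one_mul, add_neg_cancel, Complex.exp_zero]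
        simp only [e]
        have := (tendsto_const_nhds (x := (1:ℂ))).div
          (((hv 1 one_pos θ).const_mul (Complex.exp L)).const_sub 1) (by norm_num)
        simpa [Pi.div_def] using this
      have l3 := (l1.sub_const (stF σ L)).mul l2
      rw [zero_sub, mul_one] at l3
      refine l3.congr' ?_
      filter_upwards [eventually_gt_atTop L] with R hRL
      exact (stG_eq σ L _ (him R θ (uIoc_subset_uIcc hθ)) (hneL R θ hRL.ne')).symm
  -- left side
  have hexpneg : Tendsto (fun R : ℝ => Real.exp (-R)) atTop (𝓝 0) := Real.tendsto_exp_neg_atTop_nhds_zero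
  have hLft : Tendsto (fun R : ℝ => ∫ θ in (-Real.pi)..Real.pi, stG σ L (((-R:ℝ):ℂ) + θ * Complex.I)) atTop
      (𝓝 (∫ θ in (-Real.pi)..Real.pi, (0:ℂ))) := by
    have hb : ∀ᶠ R : ℝ in atTop, ∀ θ ∈ uIoc (-Real.pi) Real.pi,
        ‖stG σ L (((-R:ℝ):ℂ) + θ * Complex.I)‖ ≤ 4 * (Real.exp (-R) * (2 / Real.exp L)) := by
      filter_upwards [hexpneg.eventually (ge_mem_nhds (show 0 < Real.exp L / 2 by positivity)),
        eventually_gt_atTop (-L)] with R h2 hRL θ hθ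
      have hz := him (-R) θ (uIoc_subset_uIcc hθ)
      have hne : -R ≠ L := by intro h; linarith
      rw [stG_eq σ L _ hz (hneL (-R) θ hne), norm_mul, norm_div, hnorm]
      have hd : Real.exp L - Real.exp (-R) ≤ ‖Complex.exp (((-R:ℝ):ℂ) + θ * Complex.I) - Complex.exp L‖ := by
        have := norm_sub_norm_le (Complex.exp L) (Complex.exp (((-R:ℝ):ℂ) + θ * Complex.I))
        rwa [hnorm, hnL, norm_sub_rev] at this
      have hpos := Real.exp_pos L
      have hpos2 := Real.exp_pos (-R)
      have : Real.exp (-R) / ‖Complex.exp (((-R:ℝ):ℂ) + θ * Complex.I) - Complex.exp L‖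
          ≤ Real.exp (-R) * (2 / Real.exp L) := by
        rw [div_eq_mul_inv]
        gcongr
        rw [← inv_div]
        apply inv_anti₀ (by positivity)
        linarith
      gcongr
      exact hFd _ hz
    refine intervalIntegral.tendsto_integral_filter_of_dominated_convergence (fun _ => 4 * (1 * (2 / Real.exp L))) ?_ ?_ ?_ ?_
    · exact Eventually.of_forall fun R => hmeas (-R)
    · filter_upwards [hb, eventually_ge_atTop 0] with R hR hR0
      refine Eventually.of_forall fun θ hθ => (hR θ hθ).trans ?_
      have : Real.exp (-R) ≤ 1 := Real.exp_le_one_iff.mpr (by linarith)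
      gcongr
    · exact intervalIntegrable_const
    · refine Eventually.of_forall fun θ hθ => ?_
      refine squeeze_zero_norm' (a := fun R => 4 * (Real.exp (-R) * (2 / Real.exp L))) ?_ ?_
      · filter_upwards [hb] with R hR using hR θ hθ
      · simpa using (hexpneg.mul_const (2 / Real.exp L)).const_mul 4
  -- rectangle
  have hrect : ∀ R : ℝ, (∫ x in (-R)..R, (2 * Real.pi * Complex.I * ((g x : ℝ) : ℂ)))
      + Complex.I • (∫ θ in (-Real.pi)..Real.pi, stG σ L ((R:ℂ) + θ * Complex.I))
      - Complex.I • (∫ θ in (-Real.pi)..Real.pi, stG σ L (((-R:ℝ):ℂ) + θ * Complex.I)) = 0 := by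
    intro R
    have h := Complex.integral_boundary_rect_eq_zero_of_differentiableOn (stG σ L)
      (⟨-R, -Real.pi⟩ : ℂ) (⟨R, Real.pi⟩ : ℂ) ?_
    · simp only at h
      rw [← h, ← intervalIntegral.integral_sub]
      · congr 3
        refine funext fun x => ?_
        have hb1 : |((x:ℂ) + ((-Real.pi:ℝ):ℂ) * Complex.I).im| ≤ Real.pi := by simp [abs_of_pos hp]
        have hb2 : |((x:ℂ) + ((Real.pi:ℝ):ℂ) * Complex.I).im| ≤ Real.pi := by simp [abs_of_pos hp]
        have hn1 : ((x:ℂ) + ((-Real.pi:ℝ):ℂ) * Complex.I) ≠ L := by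
          intro h; have := congrArg Complex.im h; simp [hp.ne'] at this
        have hn2 : ((x:ℂ) + ((Real.pi:ℝ):ℂ) * Complex.I) ≠ L := by
          intro h; have := congrArg Complex.im h; simp [hp.ne'] at this
        have ex1 : Complex.exp ((x:ℂ) + ((-Real.pi:ℝ):ℂ) * Complex.I) = -(Real.exp x : ℂ) := by
          rw [Complex.exp_add]; push_cast
          rw [neg_mul, Complex.exp_neg, Complex.exp_pi_mul_I]; norm_num
        have ex2 : Complex.exp ((x:ℂ) + ((Real.pi:ℝ):ℂ) * Complex.I) = -(Real.exp x : ℂ) := by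
          rw [Complex.exp_add, Complex.exp_pi_mul_I]; push_cast; ring
        rw [stG_eq σ L _ hb1 hn1, stG_eq σ L _ hb2 hn2, ex1, ex2, ← sub_mul, sub_sub_sub_cancel_right,
          stF_jump σ h0 h1, hg]
        have hq : (-(Real.exp x : ℂ) / (-(Real.exp x : ℂ) - Complex.exp L))
            = ((Real.exp x / (Real.exp x + Real.exp L) : ℝ) : ℂ) := by
          push_cast
          rw [← neg_div_neg_eq]; congr 1 <;> ring
        rw [hq]; push_cast; ring
      · apply ContinuousOn.intervalIntegrable
        refine (stG_diff σ L h0 h1).continuousOn.comp (by fun_prop) (fun x _ => ?_)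
        simp [abs_of_pos hp]
      · apply ContinuousOn.intervalIntegrable
        refine (stG_diff σ L h0 h1).continuousOn.comp (by fun_prop) (fun x _ => ?_)
        simp [abs_of_pos hp]
    · refine (stG_diff σ L h0 h1).mono fun z hz => ?_
      have := hz.2
      simp only [mem_preimage] at this
      rw [uIcc_of_le (by linarith)] at this
      exact abs_le.mpr this
  have hH : Tendsto (fun R : ℝ => ∫ x in (-R)..R, (2 * Real.pi * Complex.I * ((g x : ℝ) : ℂ))) atTop
      (𝓝 (∫ x, (2 * Real.pi * Complex.I * ((g x : ℝ) : ℂ)))) :=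
    intervalIntegral_tendsto_integral (hint.ofReal.const_mul _) tendsto_neg_atTop_atBot tendsto_id
  have hT := (hH.add (hR.const_smul Complex.I)).sub (hLft.const_smul Complex.I)
  have hz := tendsto_nhds_unique (hT.congr hrect) tendsto_const_nhds
  rw [integral_const_mul, integral_complex_ofReal, intervalIntegral.integral_const,
    intervalIntegral.integral_const] at hz
  have hpc : (Real.pi : ℂ) ≠ 0 := by exact_mod_cast hp.ne'
  have hfin : ((∫ y, g y : ℝ) : ℂ) = stF σ L := by
    simp only [smul_eq_mul, Complex.real_smul, smul_zero] at hz
    push_cast at hz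
    have h2 : (2 * Real.pi * Complex.I) * (((∫ y, g y : ℝ) : ℂ) - stF σ L) = 0 := by
      linear_combination hz
    have h3 : (2 * Real.pi * Complex.I : ℂ) ≠ 0 := by simp [hpc]
    exact sub_eq_zero.mp ((mul_eq_zero.mp h2).resolve_left h3)
  apply Complex.ofReal_injective
  rw [hfin]
  unfold stF
  push_cast
  rfl

lemma kernel_main (σ : ℝ) (h0 : 0 < σ) (h1 : σ < 1 / 2) :
    ∃ Φ : ℝ → ℝ, (∀ x, Φ (-x) = Φ x) ∧ (∀ x, 0 ≤ Φ x) ∧ Integrable Φ ∧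
      ∀ ξ : ℝ, (∫ x : ℝ, (Φ x : ℂ) * Complex.exp (-(Complex.I * x * ξ)))
        = ((4 / (3 + (1 + ξ ^ 2) ^ σ) : ℝ) : ℂ) := by
  set a : ℝ → ℝ := fun y => Real.sqrt (1 + Real.exp y) with ha
  have hapos : ∀ y, 0 < a y := fun y => Real.sqrt_pos.mpr (by positivity)
  have hasq : ∀ y, a y ^ 2 = 1 + Real.exp y := fun y => Real.sq_sqrt (by positivity)
  have hac : Continuous a := by fun_prop
  have hWc := stW_cont σ h0 h1
  set c : ℝ → ℝ := fun y => stW σ y * (Real.exp y / (2 * a y)) with hcdef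
  have hcn : ∀ y, 0 ≤ c y := fun y => by
    have := stW_nonneg σ y h0 h1
    have := hapos y
    positivity
  have hcc : Continuous c :=
    hWc.mul (Continuous.div (by fun_prop) (by fun_prop) fun y => by have := hapos y; positivity)
  set k : ℝ × ℝ → ℝ := fun p => c p.2 * Real.exp (-(a p.2 * |p.1|)) with hk
  have hkc : Continuous k := by fun_prop
  have hkn : ∀ p, 0 ≤ k p := fun p => mul_nonneg (hcn _) (Real.exp_pos _).le
  have hki : Integrable k (volume.prod volume) := by
    rw [integrable_prod_iff' hkc.aestronglyMeasurable]
    refine ⟨Filter.Eventually.of_forall fun y => (int_exp_abs (a y) (hapos y)).1.const_mul (c y), ?_⟩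
    refine (stW_integrable σ 1 h0 h1 one_pos).congr (Filter.Eventually.of_forall fun y => ?_)
    simp only [Real.norm_of_nonneg (hkn _)]
    simp only [hk]
    rw [integral_const_mul, (int_exp_abs (a y) (hapos y)).2, hcdef]
    have h := hasq y
    have hp := (hapos y).ne'
    have : Real.exp y + 1 = a y ^ 2 := by rw [h]; ring
    rw [this]
    field_simp
  refine ⟨fun x => ∫ y, k (x, y), fun x => by simp [hk], fun x => integral_nonneg fun y => hkn _,
    hki.integral_prod_left, fun ξ => ?_⟩
  have hpos : 0 < 1 + ξ ^ 2 := by positivity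
  have hS := stieltjes σ (Real.log (1 + ξ ^ 2)) h0 h1
  rw [Real.exp_log hpos, mul_comm σ, ← Real.rpow_def_of_pos hpos] at hS
  rw [← hS, ← integral_complex_ofReal]
  have hI2 : Integrable (Function.uncurry fun (x y : ℝ) =>
      (k (x, y) : ℂ) * Complex.exp (-(Complex.I * x * ξ))) (volume.prod volume) := by
    refine hki.mono ?_ (Filter.Eventually.of_forall fun p => ?_)
    · apply Continuous.aestronglyMeasurable
      unfold Function.uncurry
      fun_prop
    · simp only [Function.uncurry, norm_mul, Complex.norm_real]
      have : ‖Complex.exp (-(Complex.I * p.1 * ξ))‖ = 1 := by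
        rw [Complex.norm_exp]; simp
      rw [this, mul_one]
  have e1 : ∀ x : ℝ, ((∫ y, k (x, y) : ℝ) : ℂ) * Complex.exp (-(Complex.I * x * ξ))
      = ∫ y : ℝ, (k (x, y) : ℂ) * Complex.exp (-(Complex.I * x * ξ)) := by
    intro x
    rw [integral_mul_const, integral_complex_ofReal]
  simp only [e1]
  rw [integral_integral_swap hI2]
  refine integral_congr_ae (Filter.Eventually.of_forall fun y => ?_)
  simp only [hk, Complex.ofReal_mul (c y), mul_assoc ((c y : ℝ) : ℂ)]
  rw [integral_const_mul, (ft_exp_abs (a y) (hapos y) ξ).2, ← Complex.ofReal_mul]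
  congr 1
  have hp := (hapos y).ne'
  rw [hcdef, hasq y]
  have : Real.exp y + (1 + ξ ^ 2) = 1 + Real.exp y + ξ ^ 2 := by ring
  rw [this]
  have : 1 + Real.exp y + ξ ^ 2 ≠ 0 := by positivity
  field_simp

/-- There is an even, nonnegative, integrable kernel of unit mass whose Fourier transform
is the symbol `m(ξ) = 4 / (3 + (1 + ξ²)^(s/2))`. -/
theorem altKernel_exists (s : ℝ) (hs : s ∈ Set.Ioo (0 : ℝ) 1) :
    ∃ Φ : ℝ → ℝ, (∀ x, Φ (-x) = Φ x) ∧ (∀ x, 0 ≤ Φ x) ∧ Integrable Φ ∧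
      (∫ x : ℝ, Φ x) = 1 ∧
      ∀ ξ : ℝ, (∫ x : ℝ, (Φ x : ℂ) * Complex.exp (-(Complex.I * x * ξ)))
        = ((4 / (3 + (1 + ξ ^ 2) ^ (s / 2)) : ℝ) : ℂ) := by
  obtain ⟨Φ, he, hn, hi, hF⟩ := kernel_main (s / 2) (by linarith [hs.1]) (by linarith [hs.2])
  refine ⟨Φ, he, hn, hi, ?_, hF⟩
  have h := hF 0
  simp only [Complex.ofReal_zero, mul_zero, neg_zero, Complex.exp_zero, mul_one] at h
  rw [integral_complex_ofReal] at h
  rw [Complex.ofReal_injective h]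
  norm_num
end

section
/- Let s ∈ (0,1), μ ∈ ℝ, P ∈ (0, ∞), and let φ be a P-periodic solution of the steady fKdV equation with wave speed μ. Then ∫_{−P/2}^{P/2} φ(x)² dx = 2(μ − 1)·∫_{−P/2}^{P/2} φ(x) dx. -/
open MeasureTheory Set

lemma bessel_inner (s t : ℝ) (ht : 0 < t) :
    Integrable (fun x : ℝ => Real.exp (-t - x ^ 2 / (4 * t)) * t ^ ((s - 3) / 2)) ∧
    (∫ x : ℝ, Real.exp (-t - x ^ 2 / (4 * t)) * t ^ ((s - 3) / 2))
      = (2 * Real.sqrt Real.pi) * (Real.exp (-t) * t ^ (s / 2 - 1)) := by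
  have hfun : (fun x : ℝ => Real.exp (-t - x ^ 2 / (4 * t)) * t ^ ((s - 3) / 2))
      = fun x : ℝ => (Real.exp (-t) * t ^ ((s - 3) / 2)) * Real.exp (-(1 / (4 * t)) * x ^ 2) := by
    funext x
    have : -t - x ^ 2 / (4 * t) = -t + (-(1 / (4 * t)) * x ^ 2) := by ring
    rw [this, Real.exp_add]; ring
  rw [hfun]
  refine ⟨(integrable_exp_neg_mul_sq (by positivity)).const_mul _, ?_⟩
  rw [integral_const_mul, integral_gaussian]
  have h1 : Real.pi / (1 / (4 * t)) = Real.pi * (2 ^ 2 * t) := by field_simp; norm_num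
  have h2 : t ^ (s / 2 - 1) = t ^ ((s - 3) / 2) * Real.sqrt t := by
    rw [Real.sqrt_eq_rpow, ← Real.rpow_add ht]; congr 1; ring
  rw [h1, Real.sqrt_mul Real.pi_pos.le, Real.sqrt_mul (by norm_num), Real.sqrt_sq (by norm_num), h2]
  ring

lemma bessel_prod_integrable (s : ℝ) (hs : 0 < s) :
    Integrable (fun p : ℝ × ℝ => Real.exp (-p.2 - p.1 ^ 2 / (4 * p.2)) * p.2 ^ ((s - 3) / 2))
      ((volume : Measure ℝ).prod (volume.restrict (Set.Ioi (0 : ℝ)))) := by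
  have hm : Measurable
      (fun p : ℝ × ℝ => Real.exp (-p.2 - p.1 ^ 2 / (4 * p.2)) * p.2 ^ ((s - 3) / 2)) := by
    fun_prop
  rw [integrable_prod_iff' hm.aestronglyMeasurable]
  constructor
  · filter_upwards [ae_restrict_mem measurableSet_Ioi] with t ht
    exact (bessel_inner s t ht).1
  · have h := (Real.GammaIntegral_convergent (s := s / 2) (by linarith)).const_mul
      (2 * Real.sqrt Real.pi)
    refine Integrable.congr h ?_
    filter_upwards [ae_restrict_mem measurableSet_Ioi] with t ht
    rw [← (bessel_inner s t ht).2]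
    congr 1
    funext x
    have ht' : (0 : ℝ) < t := ht
    rw [Real.norm_of_nonneg (by positivity)]

lemma bessel_integrable (s : ℝ) (hs : 0 < s) : Integrable (besselKernel s) :=
  (bessel_prod_integrable s hs).integral_prod_left.const_mul _

lemma bessel_integral (s : ℝ) (hs : 0 < s) : ∫ x, besselKernel s x = 1 := by
  unfold besselKernel
  rw [integral_const_mul, integral_integral_swap (bessel_prod_integrable s hs)]
  have h : (∫ t in Set.Ioi (0 : ℝ), ∫ x : ℝ, Real.exp (-t - x ^ 2 / (4 * t)) * t ^ ((s - 3) / 2))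
      = ∫ t in Set.Ioi (0 : ℝ), (2 * Real.sqrt Real.pi) * (Real.exp (-t) * t ^ (s / 2 - 1)) :=
    setIntegral_congr_fun measurableSet_Ioi (fun t ht => (bessel_inner s t ht).2)
  rw [h, integral_const_mul, ← Real.Gamma_eq_integral (by linarith)]
  have := Real.Gamma_pos_of_pos (s := s / 2) (by linarith)
  have := Real.sqrt_pos.2 Real.pi_pos
  field_simp

/-- The `L²` identity for periodic fKdV traveling waves. -/
theorem fKdV_L2_identity (s μ P : ℝ) (hs : s ∈ Set.Ioo (0 : ℝ) 1) (hP : 0 < P)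
    (φ : ℝ → ℝ) (hφ : IsFKdVSolution s μ φ) (hper : Function.Periodic φ P) :
    (∫ x in (-(P / 2))..(P / 2), (φ x) ^ 2)
      = 2 * (μ - 1) * ∫ x in (-(P / 2))..(P / 2), φ x := by
  obtain ⟨hc, ⟨M, hM⟩, heq⟩ := hφ
  have hK := bessel_integrable s hs.1
  have hconv : ∀ x, (∫ z, besselKernel s z * φ (x - z)) = μ * φ x - φ x ^ 2 / 2 := by
    intro x
    have h1 := integral_sub_left_eq_self (fun z => besselKernel s z * φ (x - z)) volume x
    simp only [sub_sub_cancel] at h1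
    rw [← h1]; linarith [heq x]
  have hswap : (∫ x in (-(P / 2))..(P / 2), ∫ z, besselKernel s z * φ (x - z))
      = ∫ z, ∫ x in (-(P / 2))..(P / 2), besselKernel s z * φ (x - z) := by
    apply intervalIntegral_integral_swap
    have hfin : IsFiniteMeasure (volume.restrict (Set.uIoc (-(P / 2)) (P / 2))) := by
      unfold Set.uIoc; infer_instance
    refine (hK.comp_snd (volume.restrict (Set.uIoc (-(P / 2)) (P / 2)))).mul_bdd (c := M)
      (g := fun p : ℝ × ℝ => φ (p.1 - p.2)) ?_ ?_
    · exact (by fun_prop : Continuous fun p : ℝ × ℝ => φ (p.1 - p.2)).aestronglyMeasurable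
    · exact Filter.Eventually.of_forall fun p => hM _
  have hshift : ∀ z, (∫ x in (-(P / 2))..(P / 2), besselKernel s z * φ (x - z))
      = besselKernel s z * ∫ x in (-(P / 2))..(P / 2), φ x := by
    intro z
    rw [intervalIntegral.integral_const_mul, intervalIntegral.integral_comp_sub_right]
    have := hper.intervalIntegral_add_eq (-(P / 2) - z) (-(P / 2))
    rw [show -(P / 2) - z + P = P / 2 - z by ring, show -(P / 2) + P = P / 2 by ring] at this
    rw [this]
  simp_rw [hshift, hconv] at hswap
  rw [integral_mul_const, bessel_integral s hs.1, intervalIntegral.integral_sub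
    ((by fun_prop : Continuous fun x => μ * φ x).intervalIntegrable _ _)
    ((by fun_prop : Continuous fun x => φ x ^ 2 / 2).intervalIntegrable _ _),
    intervalIntegral.integral_const_mul, intervalIntegral.integral_div] at hswap
  linarith
end

section
/- Let s ∈ (0,1), μ ∈ ℝ, P ∈ (0, ∞), and let φ be a P-periodic, nonconstant, even, continuously differentiable solution of the steady fKdV equation with wave speed μ which is nondecreasing on (−P/2, 0). Then φ'(x) > 0 and φ(x) < μ for all x ∈ (−P/2, 0). If in addition φ is twice continuously differentiable, then φ''(0) < 0 and φ''(P/2) > 0 (hence also φ''(−P/2) > 0 by evenness and periodicity). -/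
open MeasureTheory Set

open Filter Topology

namespace FKdV

lemma integrand_int (s : ℝ) (hs : s ∈ Set.Ioo (0 : ℝ) 1) (x : ℝ) (hx : 0 < x) :
    IntegrableOn (fun u : ℝ => Real.exp (-x * (u + 1 / (4 * u))) * u ^ ((s - 3) / 2)) (Ioi 0) := by
  obtain ⟨hs0, hs1⟩ := hs
  have h1 : IntegrableOn (fun u : ℝ => u ^ ((s - 1) / 2) * Real.exp (-x * u ^ (1 : ℝ))) (Ioi 0) :=
    integrableOn_rpow_mul_exp_neg_mul_rpow (by linarith) one_pos hx
  refine Integrable.mono' (h1.const_mul (4 / x)) ?_ ?_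
  · refine (Measurable.aestronglyMeasurable ?_)
    fun_prop
  · refine (ae_restrict_mem measurableSet_Ioi).mono fun u hu => ?_
    have hu : 0 < u := hu
    have hpow : u ^ ((s - 1) / 2) = u ^ ((s - 3) / 2) * u := by
      rw [show (s - 1) / 2 = (s - 3) / 2 + 1 by ring, Real.rpow_add hu, Real.rpow_one]
    have hp : 0 < u ^ ((s - 3) / 2) := Real.rpow_pos_of_pos hu _
    rw [Real.norm_of_nonneg (by positivity), Real.rpow_one, hpow]
    have e1 : Real.exp (-x * (u + 1 / (4 * u))) = Real.exp (-x * u) * Real.exp (-(x / (4 * u))) := by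
      rw [← Real.exp_add]; congr 1; field_simp; ring
    have e2 : Real.exp (-(x / (4 * u))) ≤ 4 * u / x := by
      rw [Real.exp_neg]
      have h := Real.add_one_le_exp (x / (4 * u))
      have : 0 < x / (4 * u) := by positivity
      calc (Real.exp (x / (4 * u)))⁻¹ ≤ (x / (4 * u))⁻¹ := by
            apply inv_anti₀ this; linarith
        _ = 4 * u / x := by rw [inv_div]
    rw [e1]
    calc Real.exp (-x * u) * Real.exp (-(x / (4 * u))) * u ^ ((s - 3) / 2)
        ≤ Real.exp (-x * u) * (4 * u / x) * u ^ ((s - 3) / 2) := by gcongr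
      _ = _ := by field_simp

/-- The scaled integral. -/
noncomputable def Lf (s x : ℝ) : ℝ :=
  ∫ u in Ioi (0 : ℝ), Real.exp (-x * (u + 1 / (4 * u))) * u ^ ((s - 3) / 2)

lemma Lf_pos (s : ℝ) (hs : s ∈ Set.Ioo (0 : ℝ) 1) (x : ℝ) (hx : 0 < x) : 0 < Lf s x := by
  unfold Lf
  rw [setIntegral_pos_iff_support_of_nonneg_ae]
  · have : Function.support (fun u : ℝ => Real.exp (-x * (u + 1 / (4 * u))) * u ^ ((s - 3) / 2))
        ∩ Ioi 0 = Ioi 0 := by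
      apply inter_eq_right.2
      intro u hu
      have hu : 0 < u := hu
      have hp : 0 < u ^ ((s - 3) / 2) := Real.rpow_pos_of_pos hu _
      exact (by positivity : 0 < Real.exp (-x * (u + 1 / (4 * u))) * u ^ ((s - 3) / 2)).ne'
    rw [this]; simp
  · refine (ae_restrict_mem measurableSet_Ioi).mono fun u hu => ?_
    have hu : 0 < u := hu
    have hp : 0 < u ^ ((s - 3) / 2) := Real.rpow_pos_of_pos hu _
    show (0:ℝ) ≤ _
    positivity
  · exact integrand_int s hs x hx

lemma Lf_anti (s : ℝ) (hs : s ∈ Set.Ioo (0 : ℝ) 1) : AntitoneOn (Lf s) (Ioi 0) := by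
  intro x hx y hy hxy
  refine setIntegral_mono_on (integrand_int s hs y hy) (integrand_int s hs x hx)
    measurableSet_Ioi fun u hu => ?_
  have hu : 0 < u := hu
  have hp : 0 < u ^ ((s - 3) / 2) := Real.rpow_pos_of_pos hu _
  have : 0 < u + 1 / (4 * u) := by positivity
  gcongr

lemma Lf_convex (s : ℝ) (hs : s ∈ Set.Ioo (0 : ℝ) 1) : ConvexOn ℝ (Ioi 0) (Lf s) := by
  refine ⟨convex_Ioi 0, fun x hx y hy a b ha hb hab => ?_⟩
  have hx : 0 < x := hx
  have hy : 0 < y := hy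
  have hz : 0 < a * x + b * y := (convex_Ioi (0:ℝ)) hx hy ha hb hab
  simp only [smul_eq_mul]
  unfold Lf
  rw [← integral_const_mul, ← integral_const_mul, ← integral_add
    ((integrand_int s hs x hx).const_mul a) ((integrand_int s hs y hy).const_mul b)]
  refine setIntegral_mono_on (integrand_int s hs _ hz)
    (((integrand_int s hs x hx).const_mul a).add ((integrand_int s hs y hy).const_mul b))
    measurableSet_Ioi fun u hu => ?_
  have hu : 0 < u := hu
  have hp : 0 < u ^ ((s - 3) / 2) := Real.rpow_pos_of_pos hu _
  set w := u + 1 / (4 * u)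
  have := convexOn_exp.2 (mem_univ (-x * w)) (mem_univ (-y * w)) ha hb hab
  simp only [smul_eq_mul] at this
  have e : -(a * x + b * y) * w = a * (-x * w) + b * (-y * w) := by ring
  rw [e]
  calc _ ≤ (a * Real.exp (-x * w) + b * Real.exp (-y * w)) * u ^ ((s - 3) / 2) := by gcongr
    _ = _ := by ring

lemma kernel_const_pos (s : ℝ) (hs : s ∈ Set.Ioo (0 : ℝ) 1) :
    0 < 1 / (2 * Real.sqrt Real.pi * Real.Gamma (s / 2)) := by
  have := Real.Gamma_pos_of_pos (half_pos hs.1)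
  have := Real.pi_pos
  positivity

lemma kernel_eq (s : ℝ) (x : ℝ) (hx : 0 < x) :
    besselKernel s x = (1 / (2 * Real.sqrt Real.pi * Real.Gamma (s / 2))) *
      (x ^ ((s - 1) / 2) * Lf s x) := by
  unfold besselKernel Lf
  congr 1
  have := integral_comp_mul_left_Ioi
    (fun t : ℝ => Real.exp (-t - x ^ 2 / (4 * t)) * t ^ ((s - 3) / 2)) 0 hx
  rw [mul_zero, smul_eq_mul] at this
  rw [← mul_right_inj' (inv_pos.2 hx).ne', ← this, ← mul_assoc, ← integral_const_mul]
  refine setIntegral_congr_fun measurableSet_Ioi fun u hu => ?_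
  have hu : 0 < u := hu
  rw [Real.mul_rpow hx.le hu.le]
  have e1 : x⁻¹ * x ^ ((s - 1) / 2) = x ^ ((s - 3) / 2) := by
    rw [← Real.rpow_neg_one, ← Real.rpow_add hx]; congr 1; ring
  rw [e1]
  have e2 : -(x * u) - x ^ 2 / (4 * (x * u)) = -x * (u + 1 / (4 * u)) := by
    field_simp; ring
  rw [e2]; ring

lemma pow_strict (g : ℝ) (hg : 0 < g) : StrictConvexOn ℝ (Ioi 0) (fun x : ℝ => x ^ (-g)) := by
  refine ⟨convex_Ioi 0, fun x hx y hy hne a b ha hb hab => ?_⟩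
  have hz : 0 < a * x + b * y := (convex_Ioi (0:ℝ)) hx hy ha.le hb.le hab
  have h := strictConcaveOn_log_Ioi.2 hx hy hne ha hb hab
  have hx : 0 < x := hx
  have hy : 0 < y := hy
  simp only [smul_eq_mul] at *
  rw [Real.rpow_def_of_pos hz, Real.rpow_def_of_pos hx, Real.rpow_def_of_pos hy]
  have h2 := convexOn_exp.2 (mem_univ (Real.log x * -g)) (mem_univ (Real.log y * -g)) ha.le hb.le hab
  simp only [smul_eq_mul] at h2
  refine lt_of_lt_of_le (Real.exp_lt_exp.2 ?_) h2
  nlinarith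

lemma kernel_anti (s : ℝ) (hs : s ∈ Set.Ioo (0 : ℝ) 1) : AntitoneOn (besselKernel s) (Ioi 0) := by
  intro x hx y hy hxy
  have hx : 0 < x := hx
  have hy : 0 < y := hy
  rw [kernel_eq s x hx, kernel_eq s y hy]
  have h1 := Lf_anti s hs hx hy hxy
  have h2 := Lf_pos s hs y hy
  have h3 : y ^ ((s - 1) / 2) ≤ x ^ ((s - 1) / 2) :=
    Real.rpow_le_rpow_of_nonpos hx hxy (by linarith [hs.2])
  have := kernel_const_pos s hs
  have h4 := Real.rpow_pos_of_pos hx ((s - 1) / 2)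
  gcongr

lemma kernel_strict (s : ℝ) (hs : s ∈ Set.Ioo (0 : ℝ) 1) :
    StrictConvexOn ℝ (Ioi 0) (besselKernel s) := by
  refine ⟨convex_Ioi 0, fun x hx y hy hne a b ha hb hab => ?_⟩
  have hz : a • x + b • y ∈ Ioi (0:ℝ) := (convex_Ioi (0:ℝ)) hx hy ha.le hb.le hab
  have h1 := (pow_strict ((1 - s) / 2) (by linarith [hs.2])).2 hx hy hne ha hb hab
  rw [show -((1 - s) / 2) = (s - 1) / 2 by ring] at h1
  have h2 := (Lf_convex s hs).2 hx hy ha.le hb.le hab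
  have h3 := Lf_pos s hs _ hz
  have hc := kernel_const_pos s hs
  rw [kernel_eq s x hx, kernel_eq s y hy, kernel_eq s _ hz]
  have hm : 0 ≤ (x ^ ((s - 1) / 2) - y ^ ((s - 1) / 2)) * (Lf s x - Lf s y) := by
    rcases le_total x y with h | h
    · have := Lf_anti s hs hx hy h
      have h5 := Real.rpow_le_rpow_of_nonpos (z := (s - 1) / 2) hx h (by linarith [hs.2])
      exact mul_nonneg (by linarith) (by linarith)
    · have := Lf_anti s hs hy hx h
      have h5 := Real.rpow_le_rpow_of_nonpos (z := (s - 1) / 2) hy h (by linarith [hs.2])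
      exact mul_nonneg_of_nonpos_of_nonpos (by linarith) (by linarith)
  have h4 := Real.rpow_pos_of_pos hx ((s - 1) / 2)
  have h5 := Real.rpow_pos_of_pos hy ((s - 1) / 2)
  simp only [smul_eq_mul] at *
  generalize Lf s (a * x + b * y) = Lz at *
  generalize (a * x + b * y) ^ ((s - 1) / 2) = fz at *
  generalize Lf s x = Lx at *
  generalize Lf s y = Ly at *
  generalize x ^ ((s - 1) / 2) = fx at *
  generalize y ^ ((s - 1) / 2) = fy at *
  generalize 1 / (2 * Real.sqrt Real.pi * Real.Gamma (s / 2)) = c at *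
  have key : fz * Lz < a * (fx * Lx) + b * (fy * Ly) := by
    calc fz * Lz < (a * fx + b * fy) * Lz := by gcongr
      _ ≤ (a * fx + b * fy) * (a * Lx + b * Ly) := by gcongr
      _ ≤ a * (fx * Lx) + b * (fy * Ly) := by
        have hb' : b = 1 - a := by linarith
        have : 0 ≤ a * b * ((fx - fy) * (Lx - Ly)) := by positivity
        subst hb'
        nlinarith
  calc c * (fz * Lz) < c * (a * (fx * Lx) + b * (fy * Ly)) := by gcongr
    _ = _ := by ring

lemma kernel_even (s x : ℝ) : besselKernel s (-x) = besselKernel s x := by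
  unfold besselKernel; simp

lemma kernel_integrable (s : ℝ) (hs : s ∈ Set.Ioo (0 : ℝ) 1) : Integrable (besselKernel s) := by
  unfold besselKernel
  apply Integrable.const_mul
  have hmeas : Measurable (fun p : ℝ × ℝ =>
      Real.exp (-p.2 - p.1 ^ 2 / (4 * p.2)) * p.2 ^ ((s - 3) / 2)) := by fun_prop
  have : Integrable (fun p : ℝ × ℝ =>
      Real.exp (-p.2 - p.1 ^ 2 / (4 * p.2)) * p.2 ^ ((s - 3) / 2))
      (volume.prod (volume.restrict (Ioi 0))) := by
    rw [integrable_prod_iff' hmeas.aestronglyMeasurable]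
    have e : ∀ t : ℝ, 0 < t → ∀ x : ℝ, Real.exp (-t - x ^ 2 / (4 * t)) * t ^ ((s - 3) / 2)
        = Real.exp (-(1 / (4 * t)) * x ^ 2) * (Real.exp (-t) * t ^ ((s - 3) / 2)) := by
      intro t ht x
      rw [← mul_assoc, ← Real.exp_add]; congr 2; field_simp; ring
    constructor
    · refine (ae_restrict_mem measurableSet_Ioi).mono fun t ht => ?_
      have ht : 0 < t := ht
      simp only [e t ht]
      exact (integrable_exp_neg_mul_sq (by positivity)).mul_const _
    · have hG : IntegrableOn (fun t : ℝ => Real.exp (-t) * t ^ (s / 2 - 1)) (Ioi 0) :=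
        Real.GammaIntegral_convergent (half_pos hs.1)
      refine (hG.const_mul (Real.sqrt (4 * Real.pi))).congr ?_
      refine (ae_restrict_mem measurableSet_Ioi).mono fun t ht => ?_
      have ht : 0 < t := ht
      have hp : 0 < t ^ ((s - 3) / 2) := Real.rpow_pos_of_pos ht _
      simp only
      have : ∀ x : ℝ, ‖Real.exp (-t - x ^ 2 / (4 * t)) * t ^ ((s - 3) / 2)‖
        = Real.exp (-(1 / (4 * t)) * x ^ 2) * (Real.exp (-t) * t ^ ((s - 3) / 2)) := by
        intro x
        rw [Real.norm_of_nonneg (by positivity), e t ht]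
      simp only [this]
      rw [integral_mul_const, integral_gaussian]
      have e3 : Real.pi / (1 / (4 * t)) = (4 * Real.pi) * t := by field_simp
      rw [e3, Real.sqrt_mul (by positivity : 0 ≤ 4 * Real.pi) t, Real.sqrt_eq_rpow t]
      rw [show s / 2 - 1 = 1 / 2 + (s - 3) / 2 by ring, Real.rpow_add ht]
      ring
  exact this.integral_prod_left

lemma major {K : ℝ → ℝ} (hK : ConvexOn ℝ (Ioi 0) K) {a b m n : ℝ} (ha : 0 < a) (ham : a ≤ m)
    (hmb : m ≤ b) (h : m + n = a + b) : K m + K n ≤ K a + K b := by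
  rcases eq_or_lt_of_le (ham.trans hmb) with hab | hab
  · have h1 : m = a := by linarith
    have h2 : n = b := by linarith
    rw [h1, h2]
  · have hba : 0 < b - a := by linarith
    have t0 : 0 ≤ (b - m) / (b - a) := div_nonneg (by linarith) hba.le
    have t1 : 0 ≤ (m - a) / (b - a) := div_nonneg (by linarith) hba.le
    have ht : (b - m) / (b - a) + (m - a) / (b - a) = 1 := by field_simp; ring
    have hb : 0 < b := by linarith
    have k1 := hK.2 (mem_Ioi.2 ha) (mem_Ioi.2 hb) t0 t1 ht
    have k2 := hK.2 (mem_Ioi.2 hb) (mem_Ioi.2 ha) t0 t1 ht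
    have e1 : ((b - m) / (b - a)) • a + ((m - a) / (b - a)) • b = m := by
      simp only [smul_eq_mul]; field_simp; ring
    have e2 : ((b - m) / (b - a)) • b + ((m - a) / (b - a)) • a = n := by
      have : n = a + b - m := by linarith
      subst this
      simp only [smul_eq_mul]; field_simp; ring
    rw [e1] at k1
    rw [e2] at k2
    simp only [smul_eq_mul] at k1 k2
    have : (m - a) / (b - a) = 1 - (b - m) / (b - a) := by linarith
    rw [this] at k1 k2
    linarith

lemma major_strict {K : ℝ → ℝ} (hK : StrictConvexOn ℝ (Ioi 0) K) {a b m n : ℝ} (ha : 0 < a)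
    (ham : a < m) (hmb : m < b) (h : m + n = a + b) : K m + K n < K a + K b := by
  have hba : 0 < b - a := by linarith
  have t0 : 0 < (b - m) / (b - a) := div_pos (by linarith) hba
  have t1 : 0 < (m - a) / (b - a) := div_pos (by linarith) hba
  have ht : (b - m) / (b - a) + (m - a) / (b - a) = 1 := by field_simp; ring
  have hb : 0 < b := by linarith
  have k1 := hK.2 (mem_Ioi.2 ha) (mem_Ioi.2 hb) (by linarith) t0 t1 ht
  have k2 := hK.2 (mem_Ioi.2 hb) (mem_Ioi.2 ha) (by linarith) t0 t1 ht
  have e1 : ((b - m) / (b - a)) • a + ((m - a) / (b - a)) • b = m := by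
    simp only [smul_eq_mul]; field_simp; ring
  have e2 : ((b - m) / (b - a)) • b + ((m - a) / (b - a)) • a = n := by
    have : n = a + b - m := by linarith
    subst this
    simp only [smul_eq_mul]; field_simp; ring
  rw [e1] at k1
  rw [e2] at k2
  simp only [smul_eq_mul] at k1 k2
  have : (m - a) / (b - a) = 1 - (b - m) / (b - a) := by linarith
  rw [this] at k1 k2
  linarith

/-- Partial sums of the folded kernel. -/
noncomputable def Dk (K : ℝ → ℝ) (P X : ℝ) : ℕ → ℝ → ℝ
  | 0, Y => K (X - Y) - K (X + Y)
  | N + 1, Y => Dk K P X N Y + (K (X - Y + (N + 1) * P) - K (X + Y + (N + 1) * P)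
      + (K (X - Y - (N + 1) * P) - K (X + Y - (N + 1) * P)))

/-- Leading folded kernel. -/
noncomputable def Gk (K : ℝ → ℝ) (P a b : ℝ) : ℝ := K a + K (P - a) - (K b + K (P - b))

lemma pair_abs {K : ℝ → ℝ} (hKe : ∀ x, K (-x) = K x) (d c : ℝ) :
    K (d + c) + K (d - c) = K (|d| + c) + K (c - |d|) := by
  rcases abs_cases d with ⟨h, _⟩ | ⟨h, _⟩
  · rw [h, ← hKe (d - c)]; congr 2; ring
  · rw [h, ← hKe (d - c), add_comm]; congr 2 <;> ring

lemma Dk_ge {K : ℝ → ℝ} (hKe : ∀ x, K (-x) = K x) (hKc : ConvexOn ℝ (Ioi 0) K)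
    {P X Y : ℝ} (hP : 0 < P) (hX : X ∈ Ioo 0 (P / 2)) (hY : Y ∈ Ioo 0 (P / 2)) (N : ℕ) :
    Gk K P |X - Y| (X + Y) + (K (|X - Y| + (N + 1) * P) - K (X + Y + (N + 1) * P))
      ≤ Dk K P X (N + 1) Y := by
  obtain ⟨hX0, hX1⟩ := hX
  obtain ⟨hY0, hY1⟩ := hY
  have ha0 : 0 ≤ |X - Y| := abs_nonneg _
  have hab : |X - Y| < X + Y := by rw [abs_lt]; constructor <;> linarith
  have hab2 : |X - Y| < P - (X + Y) := by rw [abs_lt]; constructor <;> linarith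
  have hb : |X + Y| = X + Y := abs_of_pos (by linarith)
  induction N with
  | zero =>
    have h1 := pair_abs hKe (X - Y) P
    have h2 := pair_abs hKe (X + Y) P
    have h3 : K (X - Y) = K |X - Y| := by
      rcases abs_cases (X - Y) with ⟨h, _⟩ | ⟨h, _⟩
      · rw [h]
      · rw [h, hKe]
    rw [hb] at h2
    simp only [Dk, Gk, CharP.cast_eq_zero, zero_add, one_mul]
    linarith
  | succ N ih =>
    rw [Dk]
    have hc : (0:ℝ) < (N + 1) * P := by positivity
    have h1 := pair_abs hKe (X - Y) (((N + 1 : ℕ) + 1) * P)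
    have h2 := pair_abs hKe (X + Y) (((N + 1 : ℕ) + 1) * P)
    rw [hb] at h2
    have h3 := major hKc (a := |X - Y| + (N + 1) * P) (b := ((N + 1 : ℕ) + 1) * P - |X - Y|)
      (m := X + Y + (N + 1) * P) (n := ((N + 1 : ℕ) + 1) * P - (X + Y))
      (by linarith) (by linarith) (by push_cast; linarith) (by ring)
    linarith

lemma Gk_nonneg {K : ℝ → ℝ} (hKc : ConvexOn ℝ (Ioi 0) K)
    {P X Y : ℝ} (hX : X ∈ Ioo 0 (P / 2)) (hY : Y ∈ Ioo 0 (P / 2)) (hne : Y ≠ X) :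
    0 ≤ Gk K P |X - Y| (X + Y) := by
  obtain ⟨hX0, hX1⟩ := hX
  obtain ⟨hY0, hY1⟩ := hY
  have ha0 : 0 < |X - Y| := abs_pos.2 (sub_ne_zero.2 hne.symm)
  have hab : |X - Y| < X + Y := by rw [abs_lt]; constructor <;> linarith
  have hab2 : |X - Y| < P - (X + Y) := by rw [abs_lt]; constructor <;> linarith
  have := major hKc (a := |X - Y|) (b := P - |X - Y|) (m := X + Y) (n := P - (X + Y))
    ha0 hab.le (by linarith) (by ring)
  unfold Gk; linarith

lemma Gk_pos {K : ℝ → ℝ} (hKc : StrictConvexOn ℝ (Ioi 0) K)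
    {P X Y : ℝ} (hX : X ∈ Ioo 0 (P / 2)) (hY : Y ∈ Ioo 0 (P / 2)) (hne : Y ≠ X) :
    0 < Gk K P |X - Y| (X + Y) := by
  obtain ⟨hX0, hX1⟩ := hX
  obtain ⟨hY0, hY1⟩ := hY
  have ha0 : 0 < |X - Y| := abs_pos.2 (sub_ne_zero.2 hne.symm)
  have hab : |X - Y| < X + Y := by rw [abs_lt]; constructor <;> linarith
  have hab2 : |X - Y| < P - (X + Y) := by rw [abs_lt]; constructor <;> linarith
  have := major_strict hKc (a := |X - Y|) (b := P - |X - Y|) (m := X + Y) (n := P - (X + Y))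
    ha0 hab (by linarith) (by ring)
  unfold Gk; linarith

lemma fold {f : ℝ → ℝ} (hf : Integrable f) (c h : ℝ) :
    ∫ y in (c - h)..(c + h), f y = ∫ y in (0:ℝ)..h, (f (c + y) + f (c - y)) := by
  rw [intervalIntegral.integral_add (hf.comp_add_left c).intervalIntegrable
    (hf.comp_sub_left c).intervalIntegrable,
    intervalIntegral.integral_comp_add_left, intervalIntegral.integral_comp_sub_left,
    add_zero, sub_zero, add_comm (∫ x in c..(c + h), f x)]
  exact (intervalIntegral.integral_add_adjacent_intervals hf.intervalIntegrable
    hf.intervalIntegrable).symm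

lemma Dk_int {K : ℝ → ℝ} (hKi : Integrable K) (P X : ℝ) (N : ℕ) : Integrable (Dk K P X N) := by
  have h1 : ∀ c : ℝ, Integrable (fun Y => K (X - Y + c)) := by
    intro c
    have := hKi.comp_sub_left (X + c)
    refine this.congr (ae_of_all _ fun Y => ?_)
    simp only; congr 1; ring
  have h2 : ∀ c : ℝ, Integrable (fun Y => K (X + Y + c)) := by
    intro c
    have := hKi.comp_add_left (X + c)
    refine this.congr (ae_of_all _ fun Y => ?_)
    simp only; congr 1; ring
  induction N with
  | zero =>
    have := (h1 0).sub (h2 0)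
    simp only [add_zero] at this
    exact this
  | succ N ih =>
    exact ih.add (((h1 ((N + 1) * P)).sub (h2 ((N + 1) * P))).add
      ((h1 (-((N + 1) * P))).sub (h2 (-((N + 1) * P)))))

lemma fold_sum {K ψ : ℝ → ℝ} (hKe : ∀ x, K (-x) = K x) (hKi : Integrable K)
    {P X : ℝ} (hψc : Continuous ψ) (hodd : ∀ x, ψ (-x) = -ψ x) (hper : Function.Periodic ψ P)
    (hfi : Integrable (fun y => K (-X - y) * ψ y)) (N : ℕ) :
    ∫ y in (-((N + 1 / 2) * P))..((N + 1 / 2) * P), K (-X - y) * ψ y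
      = ∫ Y in (0:ℝ)..(P / 2), Dk K P X N Y * ψ (-Y) := by
  have hI : ∀ N, IntervalIntegrable (fun Y => Dk K P X N Y * ψ (-Y)) volume 0 (P / 2) := fun N =>
    (Dk_int hKi P X N).intervalIntegrable.mul_continuousOn (by fun_prop)
  induction N with
  | zero =>
    have := fold hfi 0 (P / 2)
    rw [show -(((0:ℕ) + 1 / 2 : ℝ) * P) = 0 - P / 2 by push_cast; ring,
      show (((0:ℕ) + 1 / 2 : ℝ) * P) = 0 + P / 2 by push_cast; ring, this]
    apply intervalIntegral.integral_congr
    intro Y _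
    simp only [Dk, zero_add, zero_sub, sub_neg_eq_add, hodd]
    rw [show -X - Y = -(X + Y) by ring, hKe, show -X + Y = -(X - Y) by ring, hKe]
    ring
  | succ N ih =>
    have e1 := fold hfi ((N + 1) * P) (P / 2)
    have e2 := fold hfi (-((N + 1) * P)) (P / 2)
    have hs : ∫ y in (-(((N + 1 : ℕ) + 1 / 2) * P))..(((N + 1 : ℕ) + 1 / 2) * P), K (-X - y) * ψ y
        = (∫ y in (-((N + 1) * P) - P / 2)..(-((N + 1) * P) + P / 2), K (-X - y) * ψ y) +
        (∫ y in (-((N + 1 / 2) * P))..((N + 1 / 2) * P), K (-X - y) * ψ y) +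
        ∫ y in ((N + 1) * P - P / 2)..((N + 1) * P + P / 2), K (-X - y) * ψ y := by
      rw [show -((N + 1 : ℝ) * P) + P / 2 = -((N + 1 / 2) * P) by ring,
        show (N + 1 : ℝ) * P - P / 2 = (N + 1 / 2) * P by ring,
        intervalIntegral.integral_add_adjacent_intervals hfi.intervalIntegrable
          hfi.intervalIntegrable,
        intervalIntegral.integral_add_adjacent_intervals hfi.intervalIntegrable
          hfi.intervalIntegrable]
      congr 1 <;> (push_cast; ring)
    have hp1 : ∀ Y, ψ (Y + (N + 1) * P) = ψ Y := by
      intro Y; have := hper.nat_mul (N + 1) Y; push_cast at this; exact this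
    have hp2 : ∀ Y, ψ (Y - (N + 1) * P) = ψ Y := by
      intro Y; have := hp1 (Y - (N + 1) * P); rw [← this]; congr 1; ring
    have hg : ∀ c, Integrable (fun Y => (K (-X - (c + Y)) * ψ (c + Y))) := fun c =>
      hfi.comp_add_left c
    have hg2 : ∀ c, Integrable (fun Y => (K (-X - (c - Y)) * ψ (c - Y))) := fun c =>
      hfi.comp_sub_left c
    have hgg : ∀ c, IntervalIntegrable (fun Y => K (-X - (c + Y)) * ψ (c + Y)
        + K (-X - (c - Y)) * ψ (c - Y)) volume 0 (P / 2) := fun c =>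
      ((hg c).add (hg2 c)).intervalIntegrable
    rw [hs, ih, e1, e2, ← intervalIntegral.integral_add (hgg _) (hI N),
      ← intervalIntegral.integral_add ((hgg _).add (hI N)) (hgg _)]
    apply intervalIntegral.integral_congr
    intro Y _
    simp only [Dk]
    have q1 : ψ (-((N + 1) * P) + Y) = - ψ (-Y) := by
      rw [show -((N + 1) * P) + Y = Y - (N + 1) * P by ring, hp2, hodd]; ring
    have q2 : ψ (-((N + 1) * P) - Y) = ψ (-Y) := by
      rw [show -((N + 1) * P) - Y = -Y - (N + 1) * P by ring, hp2]
    have q3 : ψ ((N + 1) * P + Y) = - ψ (-Y) := by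
      rw [show ((N + 1) * P) + Y = Y + (N + 1) * P by ring, hp1, hodd]; ring
    have q4 : ψ ((N + 1) * P - Y) = ψ (-Y) := by
      rw [show ((N + 1) * P) - Y = -Y + (N + 1) * P by ring, hp1]
    rw [q1, q2, q3, q4, ← hKe (-X - (-((N + 1) * P) + Y)), ← hKe (-X - (-((N + 1) * P) - Y)),
      ← hKe (-X - ((N + 1) * P + Y)), ← hKe (-X - ((N + 1) * P - Y)),
      show -(-X - (-((N + 1) * P) + Y)) = X + Y - (N + 1) * P by ring,
      show -(-X - (-((N + 1) * P) - Y)) = X - Y - (N + 1) * P by ring,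
      show -(-X - ((N + 1) * P + Y)) = X + Y + (N + 1) * P by ring,
      show -(-X - ((N + 1) * P - Y)) = X - Y + (N + 1) * P by ring]
    ring

lemma conv_lower {K ψ : ℝ → ℝ} (hKe : ∀ x, K (-x) = K x) (hKi : Integrable K)
    (hKc : ConvexOn ℝ (Ioi 0) K) (hKa : AntitoneOn K (Ioi 0))
    {P X p q c : ℝ} (hP : 0 < P) (hψc : Continuous ψ) (hodd : ∀ x, ψ (-x) = -ψ x)
    (hper : Function.Periodic ψ P)
    (hfi : Integrable (fun y => K (-X - y) * ψ y))
    (hpos : ∀ Y ∈ Ioo 0 (P / 2), 0 ≤ ψ (-Y)) (hX : X ∈ Ioo 0 (P / 2))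
    (hp : 0 < p) (hpq : p ≤ q) (hq : q < P / 2)
    (hc : ∀ Y ∈ Icc p q, Y ≠ X → c ≤ Gk K P |X - Y| (X + Y)) :
    c * ∫ Y in p..q, ψ (-Y) ≤ ∫ y, K (-X - y) * ψ y := by
  have ht : Tendsto (fun N : ℕ => ∫ y in (-((N + 1 / 2) * P))..((N + 1 / 2) * P),
      K (-X - y) * ψ y) atTop (𝓝 (∫ y, K (-X - y) * ψ y)) := by
    have h1 : Tendsto (fun N : ℕ => ((N + 1 / 2) * P : ℝ)) atTop atTop :=
      (tendsto_atTop_add_const_right _ _ tendsto_natCast_atTop_atTop).atTop_mul_const hP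
    exact intervalIntegral_tendsto_integral hfi (tendsto_neg_atTop_atBot.comp h1) h1
  refine ge_of_tendsto ht ((eventually_ge_atTop 1).mono fun N hN => ?_)
  rw [fold_sum hKe hKi hψc hodd hper hfi N]
  obtain ⟨M, rfl⟩ : ∃ M, N = M + 1 := ⟨N - 1, by omega⟩
  have hI : ∀ a b, IntervalIntegrable (fun Y => Dk K P X (M + 1) Y * ψ (-Y)) volume a b :=
    fun a b => (Dk_int hKi P X (M + 1)).intervalIntegrable.mul_continuousOn (by fun_prop)
  have hge : ∀ Y ∈ Ioo 0 (P / 2), Y ≠ X → Gk K P |X - Y| (X + Y) ≤ Dk K P X (M + 1) Y := by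
    intro Y hY hne
    have h1 := Dk_ge hKe hKc hP hX hY M
    have hc0 : (0:ℝ) < (M + 1) * P := by positivity
    have ha0 : 0 ≤ |X - Y| := abs_nonneg _
    have hab : |X - Y| ≤ X + Y := by
      rw [abs_le]; constructor <;> linarith [hX.1, hX.2, hY.1, hY.2]
    have h2 := hKa (a := |X - Y| + (M + 1) * P) (b := X + Y + (M + 1) * P)
      (by simp only [mem_Ioi]; linarith) (by simp only [mem_Ioi]; linarith) (by linarith)
    linarith
  have hne : ∀ᵐ Y : ℝ, Y ≠ X := by
    simp [ae_iff, measure_singleton]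
  have hne2 : ∀ᵐ Y : ℝ, Y ≠ P / 2 := by
    simp [ae_iff, measure_singleton]
  calc c * ∫ Y in p..q, ψ (-Y) = ∫ Y in p..q, c * ψ (-Y) := by
        rw [intervalIntegral.integral_const_mul]
    _ ≤ ∫ Y in p..q, Dk K P X (M + 1) Y * ψ (-Y) := by
        refine intervalIntegral.integral_mono_ae_restrict hpq
          (Continuous.intervalIntegrable (by fun_prop) _ _) (hI _ _) ?_
        filter_upwards [ae_restrict_mem measurableSet_Icc, ae_restrict_of_ae hne] with Y hY hYX
        have hY' : Y ∈ Ioo 0 (P / 2) := ⟨by linarith [hY.1], by linarith [hY.2]⟩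
        exact mul_le_mul_of_nonneg_right ((hc Y hY hYX).trans (hge Y hY' hYX)) (hpos Y hY')
    _ ≤ ∫ Y in (0:ℝ)..(P / 2), Dk K P X (M + 1) Y * ψ (-Y) := by
        refine intervalIntegral.integral_mono_interval hp.le hpq hq.le ?_ (hI _ _)
        filter_upwards [ae_restrict_mem measurableSet_Ioc, ae_restrict_of_ae hne,
          ae_restrict_of_ae hne2] with Y hY hYX hY2
        have hY' : Y ∈ Ioo 0 (P / 2) := ⟨hY.1, lt_of_le_of_ne hY.2 hY2⟩
        exact mul_nonneg ((Gk_nonneg hKc hX hY' hYX).trans (hge Y hY' hYX)) (hpos Y hY')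

lemma kernel_contOn (s : ℝ) (hs : s ∈ Set.Ioo (0 : ℝ) 1) : ContinuousOn (besselKernel s) (Ioi 0) :=
  (kernel_strict s hs).convexOn.continuousOn isOpen_Ioi

/-- Uniform lower bound of the folded kernel difference. -/
lemma slope_bound {K : ℝ → ℝ} (hKc : StrictConvexOn ℝ (Ioi 0) K) {P p q r : ℝ} (hP : 0 < P)
    (hp : 0 < p) (hqr : q < r) (hr : r < P / 2) :
    ∃ κ > 0, ∀ ε > 0, ε < p → ε < r - q → ∀ Z ∈ Icc p q,
      κ * ε ≤ Gk K P (Z - ε) (Z + ε) := by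
  have hr0 : ∀ Z ∈ Icc p q, 0 < r := fun Z hZ => by linarith [hZ.1, hZ.2]
  by_cases hpq : p ≤ q
  swap
  · exact ⟨1, one_pos, fun ε _ _ _ Z hZ => absurd (hZ.1.trans hZ.2) hpq⟩
  set g : ℝ → ℝ := fun z => K z + K (P - z) with hg
  have hgr : g (P / 2) < g r := by
    have := major_strict hKc (a := r) (b := P - r) (m := P / 2) (n := P / 2)
      (by linarith) (by linarith) (by linarith) (by ring)
    simp only [hg]
    rw [show P - P / 2 = P / 2 by ring]; linarith
  have hgc : ConvexOn ℝ (Ioo 0 P) g := by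
    refine ⟨convex_Ioo 0 P, fun x hx y hy a b ha hb hab => ?_⟩
    have h1 := hKc.convexOn.2 (mem_Ioi.2 hx.1) (mem_Ioi.2 hy.1) ha hb hab
    have h2 := hKc.convexOn.2 (mem_Ioi.2 (sub_pos.2 hx.2)) (mem_Ioi.2 (sub_pos.2 hy.2)) ha hb hab
    simp only [smul_eq_mul, hg] at *
    have : a * (P - x) + b * (P - y) = P - (a * x + b * y) := by
      have : b = 1 - a := by linarith
      subst this; ring
    rw [this] at h2
    linarith
  refine ⟨2 * ((g r - g (P / 2)) / (P / 2)), ?_, fun ε hε h1 h2 Z hZ => ?_⟩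
  · have : 0 < g r - g (P / 2) := by linarith
    positivity
  · obtain ⟨hZ1, hZ2⟩ := hZ
    have hs := hgc.slope_mono_adjacent (x := Z - ε) (y := Z + ε) (z := P / 2)
      ⟨by linarith, by linarith⟩ ⟨by linarith, by linarith⟩ (by linarith) (by linarith)
    have hgy : g r ≤ g (Z + ε) := by
      have := major hKc.convexOn (a := Z + ε) (b := P - (Z + ε)) (m := r) (n := P - r)
        (by linarith) (by linarith) (by linarith) (by ring)
      simpa only [hg] using this
    have hk : (g r - g (P / 2)) / (P / 2) ≤ (g (Z + ε) - g (P / 2)) / (P / 2 - (Z + ε)) := by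
      apply div_le_div₀ <;> linarith
    have e : (g (P / 2) - g (Z + ε)) / (P / 2 - (Z + ε))
        = -((g (Z + ε) - g (P / 2)) / (P / 2 - (Z + ε))) := by
      rw [← neg_div]; congr 1; ring
    rw [e, div_le_iff₀ (by linarith)] at hs
    have : Gk K P (Z - ε) (Z + ε) = g (Z - ε) - g (Z + ε) := rfl
    rw [this]
    generalize (g (Z + ε) - g (P / 2)) / (P / 2 - (Z + ε)) = w at *
    generalize (g r - g (P / 2)) / (P / 2) = v at *
    nlinarith

lemma deriv_ge {f : ℝ → ℝ} {D c δ : ℝ} (hf : HasDerivAt f D 0) (h0 : f 0 = 0) (hδ : 0 < δ)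
    (h : ∀ ε, 0 < ε → ε < δ → c * ε ≤ f ε) : c ≤ D := by
  have h1 := hf.tendsto_slope_zero_right
  refine ge_of_tendsto h1 ?_
  filter_upwards [Ioo_mem_nhdsGT hδ] with ε hε
  have h2 := h ε hε.1 hε.2
  have := hε.1
  rw [zero_add, h0, sub_zero, smul_eq_mul, inv_mul_eq_div, le_div_iff₀ this]
  exact h2

lemma main_abs {K φ ψ : ℝ → ℝ} {μ P : ℝ} (hKe : ∀ x, K (-x) = K x) (hKi : Integrable K)
    (hKc : StrictConvexOn ℝ (Ioi 0) K) (hKa : AntitoneOn K (Ioi 0)) (hP : 0 < P)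
    (hφ : Continuous φ) (hψd : ∀ x, HasDerivAt φ (ψ x) x) (hψc : Continuous ψ)
    (hodd : ∀ x, ψ (-x) = -ψ x)
    (hper : Function.Periodic ψ P) (hpos : ∀ Y ∈ Ioo 0 (P / 2), 0 ≤ ψ (-Y))
    (hne : ∃ Y ∈ Ioo 0 (P / 2), 0 < ψ (-Y))
    (hfi : ∀ x, Integrable (fun y => K (x - y) * ψ y))
    (heq : ∀ x, (μ - φ x) * ψ x = ∫ y, K (x - y) * ψ y) :
    (∀ x ∈ Ioo (-(P / 2)) (0:ℝ), 0 < ψ x ∧ φ x < μ) ∧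
    (Differentiable ℝ ψ → deriv ψ 0 < 0 ∧ 0 < deriv ψ (-(P / 2))) := by
  obtain ⟨Y0, hY0, hY0p⟩ := hne
  have hopen : ∃ η > 0, ∀ Y, |Y - Y0| < η → Y ∈ Ioo 0 (P / 2) ∧ 0 < ψ (-Y) := by
    have hU : {Y | Y ∈ Ioo 0 (P / 2) ∧ 0 < ψ (-Y)} ∈ 𝓝 Y0 :=
      inter_mem (Ioo_mem_nhds hY0.1 hY0.2)
        ((isOpen_lt continuous_const (hψc.comp continuous_neg)).mem_nhds hY0p)
    obtain ⟨η, h1, h2⟩ := Metric.mem_nhds_iff.1 hU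
    exact ⟨η, h1, fun Y hY => h2 (by rw [Metric.mem_ball, Real.dist_eq]; exact hY)⟩
  obtain ⟨η, hη, hηp⟩ := hopen
  -- positive mass on any subinterval
  have hmass : ∀ p q, p < q → (∀ Y ∈ Icc p q, |Y - Y0| < η) → 0 < ∫ Y in p..q, ψ (-Y) := by
    intro p q hpq h
    refine intervalIntegral.intervalIntegral_pos_of_pos_on
      (Continuous.intervalIntegrable (by fun_prop) _ _) (fun Y hY => ?_) hpq
    exact (hηp Y (h Y (Ioo_subset_Icc_self hY))).2
  have hcontK : ContinuousOn K (Ioi 0) := hKc.convexOn.continuousOn isOpen_Ioi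
  have hF : ∀ X ∈ Ioo 0 (P / 2), 0 < (μ - φ (-X)) * ψ (-X) := by
    intro X hX
    -- choose an interval avoiding X
    obtain ⟨p, q, hpq, hη', hX'⟩ : ∃ p q, p < q ∧ (∀ Y ∈ Icc p q, |Y - Y0| < η) ∧
        ∀ Y ∈ Icc p q, Y ≠ X := by
      rcases le_or_gt X Y0 with h | h
      · refine ⟨Y0 + η / 3, Y0 + η / 2, by linarith, fun Y hY => ?_, fun Y hY => ?_⟩
        · rw [abs_lt]; constructor <;> linarith [hY.1, hY.2]
        · have := hY.1; intro h3; linarith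
      · refine ⟨Y0 - η / 2, Y0 - η / 3, by linarith, fun Y hY => ?_, fun Y hY => ?_⟩
        · rw [abs_lt]; constructor <;> linarith [hY.1, hY.2]
        · have := hY.2; intro h3; linarith
    have hin : ∀ Y ∈ Icc p q, Y ∈ Ioo 0 (P / 2) := fun Y hY => (hηp Y (hη' Y hY)).1
    have hGc : ContinuousOn (fun Y => Gk K P |X - Y| (X + Y)) (Icc p q) := by
      unfold Gk
      have hh : ∀ f : ℝ → ℝ, Continuous f → (∀ Y ∈ Icc p q, 0 < f Y) →
          ContinuousOn (fun Y => K (f Y)) (Icc p q) := fun f hf h =>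
        hcontK.comp hf.continuousOn h
      refine ((hh _ (by fun_prop) fun Y hY => ?_).add (hh _ (by fun_prop) fun Y hY => ?_)).sub
        ((hh _ (by fun_prop) fun Y hY => ?_).add (hh _ (by fun_prop) fun Y hY => ?_))
      · exact abs_pos.2 (sub_ne_zero.2 (hX' Y hY).symm)
      · have : |X - Y| < P := by
          rw [abs_lt]; constructor <;> linarith [hX.1, hX.2, (hin Y hY).1, (hin Y hY).2]
        linarith
      · linarith [hX.1, (hin Y hY).1]
      · linarith [hX.2, (hin Y hY).2]
    obtain ⟨Ym, hYm, hmin⟩ := isCompact_Icc.exists_isMinOn (nonempty_Icc.2 hpq.le) hGc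
    have hcpos := Gk_pos hKc hX (hin Ym hYm) (hX' Ym hYm)
    have := conv_lower hKe hKi hKc.convexOn hKa hP hψc hodd hper (hfi (-X)) hpos hX
      (hin p (left_mem_Icc.2 hpq.le)).1 hpq.le (hin q (right_mem_Icc.2 hpq.le)).2
      (c := Gk K P |X - Ym| (X + Ym)) (fun Y hY _ => hmin hY)
    rw [heq]
    exact lt_of_lt_of_le (mul_pos hcpos (hmass p q hpq hη')) this
  have hpart1 : ∀ X ∈ Ioo 0 (P / 2), 0 < ψ (-X) ∧ φ (-X) < μ := by
    intro X hX
    have h1 := hF X hX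
    have h2 := hpos X hX
    have h3 : 0 < ψ (-X) := by
      rcases h2.eq_or_lt with h | h
      · rw [← h, mul_zero] at h1; exact absurd h1 (lt_irrefl _)
      · exact h
    refine ⟨h3, ?_⟩
    have := (mul_pos_iff_of_pos_right h3).1 h1
    linarith
  refine ⟨fun x hx => ?_, fun hd => ?_⟩
  · have := hpart1 (-x) ⟨by linarith [hx.2], by linarith [hx.1]⟩
    simpa using this
  have hψ0 : ψ 0 = 0 := by have := hodd 0; rw [neg_zero] at this; linarith
  have hψP : ψ (-(P / 2)) = 0 := by
    have h1 := hodd (P / 2)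
    have h2 := hper (-(P / 2))
    rw [show -(P / 2) + P = P / 2 by ring] at h2
    linarith
  have hle : ∀ x ∈ Icc (-(P / 2)) (0:ℝ), φ x ≤ μ := by
    have : closure (Ioo (-(P / 2)) (0:ℝ)) ⊆ {x | φ x ≤ μ} := by
      refine closure_minimal (fun x hx => ?_) (isClosed_le hφ continuous_const)
      have := hpart1 (-x) ⟨by linarith [hx.2], by linarith [hx.1]⟩
      rw [neg_neg] at this
      exact this.2.le
    rw [closure_Ioo (by linarith)] at this
    exact this
  have hH : ∀ x, HasDerivAt (fun x => (μ - φ x) * ψ x)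
      ((0 - ψ x) * ψ x + (μ - φ x) * deriv ψ x) x := fun x =>
    ((hasDerivAt_const x μ).sub (hψd x)).mul (hd x).hasDerivAt
  -- interval
  set p := Y0 - η / 2 with hpdef
  set q := Y0 + η / 2 with hqdef
  have hpq : p < q := by linarith
  have hη' : ∀ Y ∈ Icc p q, |Y - Y0| < η := by
    intro Y hY; rw [abs_lt]; constructor <;> linarith [hY.1, hY.2]
  have hin : ∀ Y ∈ Icc p q, Y ∈ Ioo 0 (P / 2) := fun Y hY => (hηp Y (hη' Y hY)).1
  have hp0 := (hin p (left_mem_Icc.2 hpq.le))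
  have hq0 := (hin q (right_mem_Icc.2 hpq.le))
  have hm := hmass p q hpq hη'
  constructor
  · obtain ⟨κ, hκ, hb⟩ := slope_bound hKc (p := p) (q := q) (r := (q + P / 2) / 2) hP hp0.1
      (by linarith [hq0.2]) (by linarith [hq0.2])
    have hD : HasDerivAt (fun ε => (μ - φ (-ε)) * ψ (-ε)) (-((μ - φ 0) * deriv ψ 0)) 0 := by
      have h1 := hH (-0)
      have h2 := h1.comp (0:ℝ) (hasDerivAt_neg (0:ℝ))
      refine HasDerivAt.congr_deriv h2 ?_
      rw [neg_zero, hψ0]; ring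
    have := deriv_ge hD (by rw [neg_zero, hψ0, mul_zero])
      (c := κ * ∫ Y in p..q, ψ (-Y)) (δ := min p ((q + P / 2) / 2 - q))
      (lt_min hp0.1 (by linarith [hq0.2])) (fun ε hε hε2 => by
        have h1 := hε2.trans_le (min_le_left _ _)
        have h2 := hε2.trans_le (min_le_right _ _)
        rw [heq]
        have := conv_lower hKe hKi hKc.convexOn hKa hP hψc hodd hper (hfi (-ε)) hpos
          (X := ε) ⟨hε, by linarith [hp0.2]⟩ hp0.1 hpq.le hq0.2 (c := κ * ε)
          (fun Y hY _ => by
            have h3 := hb ε hε h1 h2 Y hY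
            rw [abs_sub_comm, abs_of_pos (by linarith [hY.1]), add_comm ε Y]
            exact h3)
        linarith)
    have h0 : φ 0 ≤ μ := hle 0 ⟨by linarith, le_rfl⟩
    have hpos' : 0 < κ * ∫ Y in p..q, ψ (-Y) := mul_pos hκ hm
    by_contra hcon
    push Not at hcon
    have := mul_nonneg (sub_nonneg.2 h0) hcon
    linarith
  · obtain ⟨κ, hκ, hb⟩ := slope_bound hKc (p := P / 2 - q) (q := P / 2 - p)
      (r := ((P / 2 - p) + P / 2) / 2) hP (by linarith [hq0.2])
      (by linarith [hp0.1]) (by linarith [hp0.1])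
    have hD : HasDerivAt (fun ε => (μ - φ (-(P / 2 - ε))) * ψ (-(P / 2 - ε)))
        ((μ - φ (-(P / 2))) * deriv ψ (-(P / 2))) 0 := by
      have h1 := hH (-(P / 2 - 0))
      have h3 : HasDerivAt (fun ε : ℝ => -(P / 2 - ε)) 1 0 := by
        have := ((hasDerivAt_id (0:ℝ)).const_sub (P / 2)).neg
        exact this.congr_deriv (neg_neg 1)
      have h2 := HasDerivAt.comp (0:ℝ) h1 h3
      refine HasDerivAt.congr_deriv h2 ?_
      rw [sub_zero, hψP]; ring
    have := deriv_ge hD (by rw [sub_zero, hψP, mul_zero])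
      (c := κ * ∫ Y in p..q, ψ (-Y))
      (δ := min (P / 2 - q) (((P / 2 - p) + P / 2) / 2 - (P / 2 - p)))
      (lt_min (by linarith [hq0.2]) (by linarith [hp0.1])) (fun ε hε hε2 => by
        have h1 := hε2.trans_le (min_le_left _ _)
        have h2 := hε2.trans_le (min_le_right _ _)
        rw [heq]
        have := conv_lower hKe hKi hKc.convexOn hKa hP hψc hodd hper (hfi (-(P / 2 - ε))) hpos
          (X := P / 2 - ε) ⟨by linarith [hq0.1], by linarith⟩ hp0.1 hpq.le hq0.2 (c := κ * ε)
          (fun Y hY _ => by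
            have h3 := hb ε hε h1 h2 (P / 2 - Y) ⟨by linarith [hY.2], by linarith [hY.1]⟩
            rw [abs_of_pos (by linarith [hY.2])]
            unfold Gk at h3 ⊢
            rw [show P / 2 - ε - Y = P / 2 - Y - ε by ring,
              show P / 2 - ε + Y = P - (P / 2 - Y + ε) by ring, sub_sub_cancel]
            linarith)
        linarith)
    have h0 : φ (-(P / 2)) ≤ μ := hle _ ⟨le_rfl, by linarith⟩
    have hpos' : 0 < κ * ∫ Y in p..q, ψ (-Y) := mul_pos hκ hm
    by_contra hcon
    push Not at hcon
    have := mul_nonpos_of_nonneg_of_nonpos (sub_nonneg.2 h0) hcon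
    linarith

lemma conv_deriv {K φ : ℝ → ℝ} {C M : ℝ} (hKi : Integrable K) (hC1 : ContDiff ℝ 1 φ)
    (hM : ∀ x, |φ x| ≤ M) (hC : ∀ x, |deriv φ x| ≤ C) (x : ℝ) :
    Integrable (fun y => K (x - y) * deriv φ y) ∧
    HasDerivAt (fun x => ∫ y, K (x - y) * φ y) (∫ y, K (x - y) * deriv φ y) x := by
  have hd : Continuous (deriv φ) := hC1.continuous_deriv le_rfl
  have hφ : Continuous φ := hC1.continuous
  have e : ∀ (f : ℝ → ℝ) (x : ℝ), ∫ y, K (x - y) * f y = ∫ z, K z * f (x - z) := by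
    intro f x
    rw [← integral_sub_left_eq_self (fun z => K z * f (x - z)) volume x]
    simp
  have h := hasDerivAt_integral_of_dominated_loc_of_deriv_le (μ := volume)
    (F := fun x z => K z * φ (x - z)) (F' := fun x z => K z * deriv φ (x - z)) (x₀ := x)
    (bound := fun z => ‖K z‖ * C) (s := univ) univ_mem
    (Eventually.of_forall fun x => hKi.aestronglyMeasurable.mul
      (Continuous.aestronglyMeasurable (by fun_prop)))
    (hKi.mul_bdd (c := M) (Continuous.aestronglyMeasurable (by fun_prop))
      (ae_of_all _ fun z => hM _))
    (hKi.aestronglyMeasurable.mul (Continuous.aestronglyMeasurable (by fun_prop)))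
    (ae_of_all _ fun z y _ => by
      rw [norm_mul]; exact mul_le_mul_of_nonneg_left (hC _) (norm_nonneg _))
    (hKi.norm.mul_const C)
    (ae_of_all _ fun z y _ => by
      have h1 : HasDerivAt φ (deriv φ (y - z)) (y - z) :=
        (hC1.differentiable one_ne_zero _).hasDerivAt
      exact (h1.comp_sub_const y z).const_mul (K z))
  constructor
  · have := h.1.comp_sub_left x
    refine this.congr (ae_of_all _ fun y => ?_)
    simp
  · simp only [e]
    exact h.2

end FKdV

/-- Nodal properties of even, periodic, monotone fKdV traveling waves. -/
theorem fKdV_nodal_properties (s μ P : ℝ) (hs : s ∈ Set.Ioo (0 : ℝ) 1) (hP : 0 < P)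
    (φ : ℝ → ℝ) (hφ : IsFKdVSolution s μ φ) (hper : Function.Periodic φ P)
    (hnc : ∃ x y, φ x ≠ φ y) (heven : ∀ x, φ (-x) = φ x)
    (hC1 : ContDiff ℝ 1 φ) (hmono : MonotoneOn φ (Set.Ioo (-(P / 2)) 0)) :
    (∀ x ∈ Set.Ioo (-(P / 2)) (0 : ℝ), 0 < deriv φ x ∧ φ x < μ) ∧
    (ContDiff ℝ 2 φ →
      deriv (deriv φ) 0 < 0 ∧ 0 < deriv (deriv φ) (P / 2) ∧
        0 < deriv (deriv φ) (-(P / 2))) := by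
  obtain ⟨hcont, ⟨M, hM⟩, heq⟩ := hφ
  have hdc : Continuous (deriv φ) := hC1.continuous_deriv le_rfl
  have hd : ∀ x, HasDerivAt φ (deriv φ x) x := fun x =>
    (hC1.differentiable one_ne_zero x).hasDerivAt
  have hodd : ∀ x, deriv φ (-x) = -deriv φ x := by
    intro x
    have h1 : deriv (fun x => φ (-x)) x = -deriv φ (-x) := deriv_comp_neg φ x
    simp only [heven] at h1
    have h2 : (fun x => φ x) = φ := rfl
    linarith
  have hdper : Function.Periodic (deriv φ) P := by
    intro x
    rw [← deriv_comp_add_const φ P x]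
    congr 1
    funext y
    exact hper y
  obtain ⟨C, hC⟩ : ∃ C, ∀ x, |deriv φ x| ≤ C := by
    obtain ⟨C, hC⟩ := (isCompact_Icc (a := (0:ℝ)) (b := P)).exists_bound_of_continuousOn
      hdc.continuousOn
    refine ⟨C, fun x => ?_⟩
    obtain ⟨y, hy, hxy⟩ := hdper.exists_mem_Ico₀ hP x
    rw [hxy]
    exact hC y (Ico_subset_Icc_self hy)
  have hKi := FKdV.kernel_integrable s hs
  have hconv := FKdV.conv_deriv hKi hC1 hM hC
  have hder : ∀ x, (μ - φ x) * deriv φ x = ∫ y, besselKernel s (x - y) * deriv φ y := by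
    intro x
    have h1 := (((hd x).const_mul (-μ)).add (((hd x).pow 2).div_const 2)).add (hconv x).2
    have h2 : ∀ x, ((fun x => -μ * φ x) + (fun x => (φ ^ 2) x / 2) +
        fun x => ∫ y, besselKernel s (x - y) * φ y) x = 0 := fun x => heq x
    have h3 := h1.unique ((hasDerivAt_const x (0:ℝ)).congr_of_eventuallyEq
      (Eventually.of_forall h2))
    norm_num at h3
    linarith
  have hnonneg : ∀ x ∈ Ioo (-(P / 2)) (0:ℝ), 0 ≤ deriv φ x := by
    intro x hx
    have h1 : derivWithin φ (Ioo (-(P / 2)) 0) x = deriv φ x :=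
      derivWithin_of_isOpen isOpen_Ioo hx
    rw [← h1]
    exact hmono.derivWithin_nonneg
  have hpos : ∀ Y ∈ Ioo 0 (P / 2), 0 ≤ deriv φ (-Y) := fun Y hY =>
    hnonneg _ ⟨by linarith [hY.2], by linarith [hY.1]⟩
  have hne : ∃ Y ∈ Ioo 0 (P / 2), 0 < deriv φ (-Y) := by
    by_contra hcon
    push Not at hcon
    have hz : ∀ Y ∈ Ioo 0 (P / 2), deriv φ Y = 0 := by
      intro Y hY
      have h1 := le_antisymm (hcon Y hY) (hpos Y hY)
      rw [hodd] at h1; linarith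
    have hc : ∀ Y ∈ Icc 0 (P / 2), φ Y = φ 0 := by
      intro Y hY
      rcases hY.1.eq_or_lt with h | h
      · rw [← h]
      · obtain ⟨c, hc, he⟩ := exists_deriv_eq_slope φ h hcont.continuousOn
          (fun y _ => (hd y).differentiableAt.differentiableWithinAt)
        rw [hz c ⟨hc.1, by linarith [hc.2, hY.2]⟩] at he
        have : φ Y - φ 0 = 0 := by
          have h3 : Y - 0 ≠ 0 := by linarith
          field_simp at he
          linarith
        linarith
    have hall : ∀ x, φ x = φ 0 := by
      intro x
      obtain ⟨y, hy, hxy⟩ := hper.exists_mem_Ico hP x (-(P / 2))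
      rw [hxy]
      rcases le_total 0 y with h | h
      · exact hc y ⟨h, by linarith [hy.2]⟩
      · rw [← heven]
        exact hc (-y) ⟨by linarith, by linarith [hy.1]⟩
    obtain ⟨x, y, hxy⟩ := hnc
    exact hxy ((hall x).trans (hall y).symm)
  have hmain := FKdV.main_abs (FKdV.kernel_even s) hKi (FKdV.kernel_strict s hs)
    (FKdV.kernel_anti s hs) hP hcont hd hdc hodd hdper hpos hne (fun x => (hconv x).1) hder
  refine ⟨hmain.1, fun hC2 => ?_⟩
  have hdd : Differentiable ℝ (deriv φ) := by
    have : ContDiff ℝ 1 (deriv φ) := hC2.deriv'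
    exact this.differentiable one_ne_zero
  obtain ⟨h1, h2⟩ := hmain.2 hdd
  refine ⟨h1, ?_, h2⟩
  have h3 : deriv (deriv φ) (-(P / 2) + P) = deriv (deriv φ) (-(P / 2)) := by
    rw [← deriv_comp_add_const (deriv φ) P]
    congr 1
    funext y
    exact hdper y
  rw [show -(P / 2) + P = P / 2 by ring] at h3
  rw [h3]; exact h2
end
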